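/- arXiv:1206.1551 — 11 statements merged into one kernel-verified Lean document; each statement's English description precedes it below -/
import Mathlib

section
/- Let n ≥ 1 and let a_1 ≤ a_2 ≤ … ≤ a_n be integers with a_1 + a_2 + … + a_n = 1. Set Σ_j := a_1 + … + a_j for 1 ≤ j ≤ n−1. Define vectors b_1, …, b_n ∈ ℤ^n by: b_n := (1,1,…,1), and for 1 ≤ j ≤ n−1 the i-th coordinate of b_j equals 1−Σ_j if i ≤ j and −Σ_j if i > j. Then b_1, …, b_n form a ℤ-basis of ℤ^n, and {x ∈ ℤ^n : x_1 ≥ x_2 ≥ … ≥ x_n and a_1x_1 + … + a_nx_n ≥ 0} = {λ_1 b_1 + … + λ_n b_n : λ_1, …, λ_n ∈ ℤ_{≥0}}. -/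
/-- A vector is determined by its consecutive differences and its pairing with a weight vector
of total weight one. -/
theorem eq_of_sub_succ_eq_of_weighted_sum_eq {m : ℕ} {a x y : Fin (m + 1) → ℤ}
    (hsum : ∑ i, a i = 1)
    (hdiff : ∀ j : Fin m, x j.castSucc - x j.succ = y j.castSucc - y j.succ)
    (hpair : ∑ i, a i * x i = ∑ i, a i * y i) : x = y := by
  have hconst : ∀ i, x i = y i + (x 0 - y 0) := by
    intro i
    induction i using Fin.induction with
    | zero => ring
    | succ j ih => linarith [hdiff j]
  have hzero : x 0 - y 0 = 0 := by
    have h : ∑ i, a i * x i = ∑ i, a i * y i + (∑ i, a i) * (x 0 - y 0) := by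
      rw [Finset.sum_mul, ← Finset.sum_add_distrib]
      exact Finset.sum_congr rfl fun i _ => by rw [hconst i]; ring
    rw [hsum, hpair] at h
    linarith
  funext i
  rw [hconst i, hzero, add_zero]

/-- type A unimodularity of the fundamental cone.
Indices are 0-based: the 0-based index `j` corresponds to the 1-based index `j+1`.
`S j = a_1 + ⋯ + a_{j+1}` (1-based), and `b` is the matrix of generators:
the last column `b ⟨n-1⟩` is the all-ones vector, and for `(j:ℕ) < n-1` the
`i`-th coordinate of `b j` is `1 - S j` if `i ≤ j` and `-S j` otherwise. -/
theorem stmt_0 (n : ℕ) (hn : 1 ≤ n) (a : Fin n → ℤ)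
    (ha : Monotone a) (hsum : ∑ i, a i = 1)
    (S : Fin n → ℤ)
    (hS : ∀ j, S j = ∑ i ∈ Finset.univ.filter (fun i : Fin n => (i : ℕ) ≤ (j : ℕ)), a i)
    (b : Fin n → Fin n → ℤ)
    (hb : ∀ j i, b j i =
      if (j : ℕ) = n - 1 then 1 else if (i : ℕ) ≤ (j : ℕ) then 1 - S j else - S j) :
    Function.Bijective (fun lam : Fin n → ℤ => ∑ j, lam j • b j) ∧
    {x : Fin n → ℤ | (∀ i j : Fin n, i ≤ j → x j ≤ x i) ∧ 0 ≤ ∑ i, a i * x i} =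
      {x : Fin n → ℤ | ∃ lam : Fin n → ℕ, x = ∑ j, (lam j : ℤ) • b j} := by
  obtain ⟨m, rfl⟩ : ∃ m, n = m + 1 := ⟨n - 1, by omega⟩
  have hlast : ∀ i, b (Fin.last m) i = 1 := fun i => by simp [hb]
  have hcast : ∀ (k : Fin m) i, b k.castSucc i =
      (if (i : ℕ) ≤ (k : ℕ) then 1 else 0) - S k.castSucc := by
    intro k i
    have hk : (k : ℕ) ≠ m := k.isLt.ne
    rw [hb]
    simp only [Fin.val_castSucc, Nat.add_sub_cancel, hk, if_false]
    split_ifs <;> ring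
  have hpair_cast : ∀ k : Fin m, ∑ i, a i * b k.castSucc i = 0 := by
    intro k
    simp only [hcast, mul_sub, Finset.sum_sub_distrib, ← Finset.sum_mul, hsum, hS,
      Fin.val_castSucc, mul_ite, mul_one, mul_zero, one_mul, ← Finset.sum_filter, sub_self]
  have hdiff_cast : ∀ j k : Fin m,
      b k.castSucc j.castSucc - b k.castSucc j.succ = if k = j then 1 else 0 := by
    intro j k
    simp only [hcast, Fin.val_castSucc, Fin.val_succ, Fin.ext_iff]
    split_ifs <;> omega
  have hdiff : ∀ (lam : Fin (m + 1) → ℤ) (j : Fin m),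
      (∑ k, lam k • b k) j.castSucc - (∑ k, lam k • b k) j.succ = lam j.castSucc := by
    intro lam j
    simp only [Finset.sum_apply, Pi.smul_apply, smul_eq_mul, ← Finset.sum_sub_distrib, ← mul_sub]
    simp [Fin.sum_univ_castSucc, hlast, hdiff_cast]
  have hpair : ∀ lam : Fin (m + 1) → ℤ,
      ∑ i, a i * (∑ k, lam k • b k) i = lam (Fin.last m) := by
    intro lam
    simp only [Finset.sum_apply, Pi.smul_apply, smul_eq_mul, Finset.mul_sum]
    rw [Finset.sum_comm]
    simp only [mul_left_comm (a _), ← Finset.mul_sum]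
    simp [Fin.sum_univ_castSucc (n := m) (fun k => lam k * _), hpair_cast, hlast, hsum]
  have hrepr : ∀ (x lam : Fin (m + 1) → ℤ),
      (∀ j : Fin m, lam j.castSucc = x j.castSucc - x j.succ) →
      lam (Fin.last m) = ∑ i, a i * x i → ∑ k, lam k • b k = x := fun x lam h₁ h₂ =>
    eq_of_sub_succ_eq_of_weighted_sum_eq hsum (fun j => by rw [hdiff, h₁]) (by rw [hpair, h₂])
  refine ⟨⟨fun lam mu h => ?_, fun x => ?_⟩, Set.ext fun x => ⟨?_, ?_⟩⟩
  · dsimp only at h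
    funext k
    induction k using Fin.lastCases with
    | last => rw [← hpair lam, h, hpair]
    | cast j => rw [← hdiff lam, h, hdiff]
  · exact ⟨Fin.snoc (α := fun _ => ℤ) (fun j => x j.castSucc - x j.succ) (∑ i, a i * x i),
      hrepr x _ (by simp) (by simp)⟩
  · rintro ⟨hanti, hnonneg⟩
    refine ⟨Fin.snoc (α := fun _ => ℕ) (fun j => (x j.castSucc - x j.succ).toNat)
      (∑ i, a i * x i).toNat, (hrepr x _ (fun j => ?_) ?_).symm⟩
    · have := hanti j.castSucc j.succ j.castSucc_lt_succ.le
      simpa using this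
    · simpa using hnonneg
  · rintro ⟨lam, rfl⟩
    refine ⟨fun i j hij => ?_, ?_⟩
    · refine (Fin.antitone_iff_succ_le.2 fun k => ?_) hij
      have := hdiff (fun k => (lam k : ℤ)) k
      linarith [Int.natCast_nonneg (lam k.castSucc)]
    · rw [hpair fun k => (lam k : ℤ)]
      exact Int.natCast_nonneg _
end

section
/- Let n ≥ 1 and let a_1 ≤ a_2 ≤ … ≤ a_n be integers with a_1 + a_2 + … + a_n = 1. Set Σ_j := a_1 + … + a_j, and define b_1, …, b_n ∈ ℤ^n by: b_n := (1,1,…,1), and for 1 ≤ j ≤ n−1 the i-th coordinate b_j(i) of b_j equals 1−Σ_j if i ≤ j and −Σ_j if i > j. Let C := {x ∈ ℝ^n : ∀π ∈ S_n, a_1x_{π(1)} + … + a_nx_{π(n)} ≥ 0}. Then the map from S_n × ℤ_{≥0}^n to C ∩ ℤ^n that sends (π, λ) to the vector x defined by x_{π(i)} := Σ_{j=1}^n (λ_j + [j ∈ D(π)])·b_j(i) for 1 ≤ i ≤ n (where [P] is 1 if P holds and 0 otherwise) is a bijection. -/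
/-- A permutation sorts `f`, breaking ties by index, as soon as it does so on consecutive
positions. -/
theorem Tuple.eq_sort_of_succ {m : ℕ} (f : Fin (m + 1) → ℤ) (σ : Equiv.Perm (Fin (m + 1)))
    (h : ∀ i : Fin m, f (σ i.castSucc) < f (σ i.succ) ∨
      f (σ i.castSucc) = f (σ i.succ) ∧ σ i.castSucc < σ i.succ) :
    σ = Tuple.sort f := by
  have hmono : StrictMono fun i => toLex (f (σ i), σ i) :=
    Fin.strictMono_iff_lt_succ.2 fun i => Prod.Lex.toLex_lt_toLex.2 (h i)
  refine Tuple.eq_sort_iff.2 ⟨fun i j hij => ?_, fun i j hij heq => ?_⟩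
  · have := Prod.Lex.toLex_le_toLex.1 (hmono.monotone hij)
    grind
  · have := Prod.Lex.toLex_lt_toLex.1 (hmono hij)
    grind

/-- Two integer vectors with the same consecutive differences and the same weighted sum, for
weights of total `1`, agree. -/
theorem eq_of_sub_succ_eq_of_sum_mul_eq {m : ℕ} {a y z : Fin (m + 1) → ℤ} (hsum : ∑ i, a i = 1)
    (hdiff : ∀ i : Fin m, y i.castSucc - y i.succ = z i.castSucc - z i.succ)
    (hweight : ∑ i, a i * y i = ∑ i, a i * z i) : y = z := by
  have hconst : ∀ i, y i = z i + (y 0 - z 0) := by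
    intro i
    induction i using Fin.induction with
    | zero => ring
    | succ i ih => linarith [hdiff i]
  have hzero : y 0 - z 0 = 0 := by
    rw [Finset.sum_congr rfl fun i _ => by rw [hconst i, mul_add], Finset.sum_add_distrib,
      ← Finset.sum_mul, hsum] at hweight
    linarith
  funext i
  rw [hconst i, hzero, add_zero]

section Generators

variable {m : ℕ} {a S : Fin (m + 1) → ℤ} {b : Fin (m + 1) → Fin (m + 1) → ℤ}

theorem sum_mul_generator_sub_succ
    (hb : ∀ j i, b j i =
      if (j : ℕ) = m + 1 - 1 then 1 else if (i : ℕ) ≤ (j : ℕ) then 1 - S j else - S j)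
    (c : Fin (m + 1) → ℤ) (i : Fin m) :
    ∑ j, c j * b j i.castSucc - ∑ j, c j * b j i.succ = c i.castSucc := by
  rw [← Finset.sum_sub_distrib, Finset.sum_eq_single i.castSucc]
  · have := i.isLt
    simp only [hb, Fin.val_castSucc, Fin.val_succ]
    rw [if_neg (by omega), if_pos le_rfl, if_neg (by omega), if_neg (by omega)]
    ring
  · intro j _ hj
    have hj' : (j : ℕ) ≠ i := fun h => hj (Fin.ext h)
    simp only [hb, Fin.val_castSucc, Fin.val_succ]
    grind
  · simp

theorem sum_weight_mul_generator (hsum : ∑ i, a i = 1)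
    (hS : ∀ j, S j = ∑ i ∈ Finset.univ.filter (fun i : Fin (m + 1) => (i : ℕ) ≤ (j : ℕ)), a i)
    (hb : ∀ j i, b j i =
      if (j : ℕ) = m + 1 - 1 then 1 else if (i : ℕ) ≤ (j : ℕ) then 1 - S j else - S j)
    (c : Fin (m + 1) → ℤ) :
    ∑ i, a i * ∑ j, c j * b j i = c (Fin.last m) := by
  have hgen : ∀ j, ∑ i, a i * b j i = if j = Fin.last m then 1 else 0 := by
    intro j
    by_cases hj : j = Fin.last m
    · simp [hb, hj, hsum]
    · have hj' : (j : ℕ) ≠ m + 1 - 1 := fun h => hj (Fin.ext h)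
      have hterm : ∀ i, a i * b j i = (if (i : ℕ) ≤ (j : ℕ) then a i else 0) - a i * S j := by
        intro i
        rw [hb, if_neg hj']
        split_ifs <;> ring
      rw [if_neg hj, Finset.sum_congr rfl fun i _ => hterm i, Finset.sum_sub_distrib,
        ← Finset.sum_mul, hsum, ← Finset.sum_filter, ← hS]
      ring
  calc ∑ i, a i * ∑ j, c j * b j i = ∑ j, c j * ∑ i, a i * b j i := by
        simp only [Finset.mul_sum]
        rw [Finset.sum_comm]
        exact Finset.sum_congr rfl fun j _ => Finset.sum_congr rfl fun i _ => by ring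
    _ = c (Fin.last m) := by simp [hgen]

end Generators

/-- type A bijective parameterization of the lattice points,
Beck–Gessel–Lee–Savage. Indices are 0-based: the 0-based index `j`
corresponds to the 1-based index `j+1`. `S j = a_1 + ⋯ + a_{j+1}` (1-based),
`b` is the matrix of generators, `d π j` is the indicator of `j` being a
descent position of `π` (among the first `n-1` generator indices), and
`Φ (π, lam)` is the point `x` with `x_{π(i)} = ∑_j (lam_j + d_j) b_j(i)`,
i.e. `x k = ∑_j (lam_j + d_j) b_j(π⁻¹ k)`. The map `Φ` is a bijection from
`Sₙ × ℤ_{≥0}ⁿ` onto `C ∩ ℤⁿ`. -/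
theorem stmt_2 (n : ℕ) (hn : 1 ≤ n) (a : Fin n → ℤ)
    (ha : Monotone a) (hsum : ∑ i, a i = 1)
    (S : Fin n → ℤ)
    (hS : ∀ j, S j = ∑ i ∈ Finset.univ.filter (fun i : Fin n => (i : ℕ) ≤ (j : ℕ)), a i)
    (b : Fin n → Fin n → ℤ)
    (hb : ∀ j i, b j i =
      if (j : ℕ) = n - 1 then 1 else if (i : ℕ) ≤ (j : ℕ) then 1 - S j else - S j)
    (d : Equiv.Perm (Fin n) → Fin n → ℤ)
    (hd : ∀ π j, d π j =
      if h : (j : ℕ) + 1 < n then (if π ⟨(j : ℕ) + 1, h⟩ < π j then 1 else 0) else 0)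
    (Φ : Equiv.Perm (Fin n) × (Fin n → ℕ) → Fin n → ℤ)
    (hΦ : ∀ π lam k, Φ (π, lam) k = ∑ j, ((lam j : ℤ) + d π j) * b j (π.symm k)) :
    Function.Injective Φ ∧
    Set.range Φ = {x : Fin n → ℤ | ∀ π : Equiv.Perm (Fin n), 0 ≤ ∑ i, a i * x (π i)} := by
  obtain ⟨m, rfl⟩ : ∃ m, n = m + 1 := ⟨n - 1, by omega⟩
  have hd_castSucc : ∀ π (i : Fin m),
      d π i.castSucc = if π i.succ < π i.castSucc then 1 else 0 := by
    intro π i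
    rw [hd, dif_pos (by simp)]
    rfl
  have hd_last : ∀ π, d π (Fin.last m) = 0 := fun π => by rw [hd, dif_neg (by simp)]
  have hΦ_apply : ∀ π lam i, Φ (π, lam) (π i) = ∑ j, ((lam j : ℤ) + d π j) * b j i :=
    fun π lam i => by rw [hΦ, Equiv.symm_apply_apply]
  have hΦ_diff : ∀ π lam (i : Fin m), Φ (π, lam) (π i.castSucc) - Φ (π, lam) (π i.succ) =
      lam i.castSucc + d π i.castSucc := fun π lam i => by
    rw [hΦ_apply, hΦ_apply]
    exact sum_mul_generator_sub_succ hb (fun j => (lam j : ℤ) + d π j) i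
  have hΦ_weight : ∀ π lam, ∑ i, a i * Φ (π, lam) (π i) = lam (Fin.last m) := fun π lam => by
    simp only [hΦ_apply]
    rw [sum_weight_mul_generator hsum hS hb (fun j => (lam j : ℤ) + d π j), hd_last, add_zero]
  have hΦ_sort : ∀ π lam, π = Tuple.sort (-Φ (π, lam)) := by
    intro π lam
    refine Tuple.eq_sort_of_succ _ _ fun i => ?_
    have hdiff := hΦ_diff π lam i
    have hne : π i.castSucc ≠ π i.succ := π.injective.ne (Fin.castSucc_lt_succ).ne
    rw [hd_castSucc] at hdiff
    simp only [Pi.neg_apply]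
    split_ifs at hdiff with h
    · left
      omega
    · rcases lt_or_eq_of_le (show Φ (π, lam) (π i.succ) ≤ Φ (π, lam) (π i.castSucc) by omega)
        with hlt | heq
      · left
        omega
      · exact Or.inr ⟨by omega, lt_of_le_of_ne (not_lt.1 h) hne⟩
  refine ⟨?_, Set.Subset.antisymm ?_ ?_⟩
  · rintro ⟨π, lam⟩ ⟨ρ, mu⟩ h
    obtain rfl : π = ρ := by rw [hΦ_sort π lam, h, ← hΦ_sort ρ mu]
    refine Prod.ext rfl (funext fun j => ?_)
    induction j using Fin.lastCases with
    | last =>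
      have := hΦ_weight π lam
      rw [h, hΦ_weight π mu] at this
      exact_mod_cast this.symm
    | cast i =>
      have := hΦ_diff π lam i
      rw [h, hΦ_diff π mu i] at this
      dsimp only
      omega
  · rintro _ ⟨⟨π, lam⟩, rfl⟩ σ
    have hanti : Antitone (Φ (π, lam) ∘ π) := by
      have := Tuple.monotone_sort (-Φ (π, lam))
      rw [← hΦ_sort π lam] at this
      exact fun i j hij => neg_le_neg_iff.1 (this hij)
    calc (0 : ℤ) ≤ lam (Fin.last m) := Int.natCast_nonneg _
      _ = ∑ i, a i * Φ (π, lam) (π i) := (hΦ_weight π lam).symm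
      _ ≤ ∑ i, a i * (Φ (π, lam) ∘ π) ((σ.trans π.symm) i) :=
        (ha.antivary hanti).sum_mul_le_sum_mul_comp_perm
      _ = ∑ i, a i * Φ (π, lam) (σ i) := by simp
  · intro x hx
    obtain ⟨hmono, htie⟩ := Tuple.eq_sort_iff.1 (Eq.refl (Tuple.sort (-x)))
    set π := Tuple.sort (-x)
    have hnonneg : ∀ i : Fin m, 0 ≤ x (π i.castSucc) - x (π i.succ) - d π i.castSucc := by
      intro i
      have hle := hmono (Fin.castSucc_lt_succ (i := i)).le
      have hlt := htie _ _ (Fin.castSucc_lt_succ (i := i))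
      simp only [Function.comp_apply, Pi.neg_apply] at hle hlt
      rw [hd_castSucc]
      split_ifs with h
      · have hne : -x (π i.castSucc) ≠ -x (π i.succ) := fun heq => lt_asymm h (hlt heq)
        omega
      · omega
    let lam : Fin (m + 1) → ℕ := Fin.lastCases (∑ i, a i * x (π i)).toNat
      fun i => (x (π i.castSucc) - x (π i.succ) - d π i.castSucc).toNat
    have heq : (fun i => Φ (π, lam) (π i)) = fun i => x (π i) := by
      refine eq_of_sub_succ_eq_of_sum_mul_eq hsum (fun i => ?_) ?_
      · rw [hΦ_diff]
        simp only [lam, Fin.lastCases_castSucc, Int.toNat_of_nonneg (hnonneg i)]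
        ring
      · rw [hΦ_weight]
        simp only [lam, Fin.lastCases_last, Int.toNat_of_nonneg (hx π)]
    exact ⟨(π, lam), π.surjective.injective_comp_right heq⟩
end

section
/- Let n ≥ 2 and let a_1, …, a_{n−1} be integers with 0 ≤ a_1 ≤ a_2 ≤ … ≤ a_{n−1}. Set Σ_j := a_j + a_{j+1} + … + a_{n−1} for 1 ≤ j ≤ n−1. Define b_j := e_j + e_{j+1} + … + e_{n−1} + Σ_j·e_n ∈ ℤ^n for 1 ≤ j ≤ n−1, and b_n := e_n, where e_1, …, e_n is the standard basis of ℤ^n. Then b_1, …, b_n form a ℤ-basis of ℤ^n, and {x ∈ ℤ^n : 0 ≤ x_1 ≤ x_2 ≤ … ≤ x_{n−1} and a_1x_1 + … + a_{n−1}x_{n−1} ≤ x_n} = {λ_1 b_1 + … + λ_n b_n : λ_1, …, λ_n ∈ ℤ_{≥0}}. -/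
/-- The sequence of consecutive differences `x j - x (j - 1)`, with `x (-1) = 0`. -/
def consecutiveDiff {m : ℕ} (x : Fin m → ℤ) (j : Fin m) : ℤ :=
  x j - if 0 < (j : ℕ) then x ⟨j - 1, by omega⟩ else 0

theorem Fin.sum_Iic_mk_succ {m k : ℕ} (hk : k + 1 < m) (f : Fin m → ℤ) :
    ∑ j ∈ Finset.Iic (⟨k + 1, hk⟩ : Fin m), f j =
      f ⟨k + 1, hk⟩ + ∑ j ∈ Finset.Iic (⟨k, by omega⟩ : Fin m), f j := by
  rw [← Finset.sum_insert (by simp [Fin.le_def])]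
  congr 1
  ext j
  simp only [Finset.mem_Iic, Finset.mem_insert, Fin.le_def, Fin.ext_iff]
  omega

theorem Fin.sum_Iic_mk_zero {m : ℕ} (hm : 0 < m) (f : Fin m → ℤ) :
    ∑ j ∈ Finset.Iic (⟨0, hm⟩ : Fin m), f j = f ⟨0, hm⟩ := by
  have h : Finset.Iic (⟨0, hm⟩ : Fin m) = {⟨0, hm⟩} := by
    ext j
    simp [Fin.le_def, Fin.ext_iff]
  rw [h, Finset.sum_singleton]

theorem sum_Iic_consecutiveDiff {m : ℕ} (x : Fin m → ℤ) (i : Fin m) :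
    ∑ j ∈ Finset.Iic i, consecutiveDiff x j = x i := by
  obtain ⟨k, hk⟩ := i
  induction k with
  | zero => simp [Fin.sum_Iic_mk_zero, consecutiveDiff]
  | succ k ih =>
    rw [Fin.sum_Iic_mk_succ, ih]
    simp [consecutiveDiff]

theorem consecutiveDiff_sum_Iic {m : ℕ} (f : Fin m → ℤ) :
    consecutiveDiff (fun i => ∑ j ∈ Finset.Iic i, f j) = f := by
  ext ⟨k, hk⟩
  cases k with
  | zero => simp [Fin.sum_Iic_mk_zero, consecutiveDiff]
  | succ k => simp [Fin.sum_Iic_mk_succ, consecutiveDiff]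

theorem consecutiveDiff_nonneg {m : ℕ} {x : Fin m → ℤ} (h0 : ∀ i, 0 ≤ x i) (hx : Monotone x)
    (j : Fin m) : 0 ≤ consecutiveDiff x j := by
  unfold consecutiveDiff
  split_ifs
  · exact sub_nonneg.2 (hx (by simp [Fin.le_def]))
  · simpa using h0 j


/-- type B unimodularity of the fundamental cone.
Indices are 0-based: the 0-based index `j` corresponds to the 1-based index
`j+1`; the first `n-1` coordinates are indexed by `Fin (n-1)` embedded in
`Fin n` via `Fin.castLE`, and the last coordinate is `⟨n-1, _⟩`.
`S j = a_{j+1} + ⋯ + a_{n-1}` (1-based), `b j = e_j + ⋯ + e_{n-2} + S j • e_{n-1}`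
for `(j:ℕ) < n-1` and `b ⟨n-1⟩ = e_{n-1}` (0-based coordinates). -/
theorem stmt_4 (n : ℕ) (hn : 2 ≤ n) (a : Fin (n - 1) → ℤ)
    (ha0 : ∀ i, 0 ≤ a i) (ha : Monotone a)
    (S : ℕ → ℤ)
    (hS : ∀ j, S j = ∑ i ∈ Finset.univ.filter (fun i : Fin (n - 1) => j ≤ (i : ℕ)), a i)
    (b : Fin n → Fin n → ℤ)
    (hb : ∀ j i, b j i =
      if (j : ℕ) = n - 1 then (if (i : ℕ) = n - 1 then 1 else 0)
      else if (i : ℕ) = n - 1 then S (j : ℕ)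
      else if (j : ℕ) ≤ (i : ℕ) then 1 else 0) :
    Function.Bijective (fun lam : Fin n → ℤ => ∑ j, lam j • b j) ∧
    {x : Fin n → ℤ |
        (∀ i : Fin (n - 1), 0 ≤ x (Fin.castLE (by omega) i)) ∧
        (∀ i j : Fin (n - 1), i ≤ j → x (Fin.castLE (by omega) i) ≤ x (Fin.castLE (by omega) j)) ∧
        ∑ i : Fin (n - 1), a i * x (Fin.castLE (by omega) i) ≤ x ⟨n - 1, by omega⟩} =
      {x : Fin n → ℤ | ∃ lam : Fin n → ℕ, x = ∑ j, (lam j : ℤ) • b j} := by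
  obtain ⟨m, rfl⟩ : ∃ m, n = m + 1 := ⟨n - 1, by omega⟩
  change Fin m → ℤ at a
  change ∀ j, S j = ∑ i ∈ Finset.univ.filter (fun i : Fin m => j ≤ (i : ℕ)), a i at hS
  simp only [Nat.add_sub_cancel] at hb
  change _ ∧ {x : Fin (m + 1) → ℤ | (∀ i : Fin m, 0 ≤ x i.castSucc) ∧
    (∀ i j : Fin m, i ≤ j → x i.castSucc ≤ x j.castSucc) ∧
    ∑ i : Fin m, a i * x i.castSucc ≤ x (Fin.last m)} = _
  have init_eq (lam : Fin (m + 1) → ℤ) (i : Fin m) :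
      (∑ j, lam j • b j) i.castSucc = ∑ j ∈ Finset.Iic i, lam j.castSucc := by
    have hi : (i : ℕ) ≠ m := i.2.ne
    have hj (j : Fin m) : (j : ℕ) ≠ m := j.2.ne
    simp [Fin.sum_univ_castSucc, hb, hi, hj, ← Finset.sum_filter, Finset.filter_ge_eq_Iic]
  have last_eq (lam : Fin (m + 1) → ℤ) :
      (∑ j, lam j • b j) (Fin.last m) =
        ∑ i, a i * ∑ j ∈ Finset.Iic i, lam j.castSucc + lam (Fin.last m) := by
    have hj (j : Fin m) : (j : ℕ) ≠ m := j.2.ne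
    simp only [Finset.sum_apply, Pi.smul_apply, smul_eq_mul, Fin.sum_univ_castSucc, hb,
      Fin.val_last, Fin.val_castSucc, hj, if_true, if_false, mul_one, hS, Finset.mul_sum]
    congr 1
    simp only [← Finset.filter_ge_eq_Iic, Finset.sum_filter]
    rw [Finset.sum_comm]
    simp only [Fin.le_def, mul_comm]
  have recover (x : Fin (m + 1) → ℤ) :
      ∑ j, (Fin.snoc (α := fun _ => ℤ) (consecutiveDiff fun i => x i.castSucc)
        (x (Fin.last m) - ∑ i, a i * x i.castSucc) : Fin (m + 1) → ℤ) j • b j = x := by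
    ext i
    refine Fin.lastCases ?_ (fun i => ?_) i
    · rw [last_eq]
      simp [sum_Iic_consecutiveDiff]
    · rw [init_eq]
      simp [sum_Iic_consecutiveDiff]
  refine ⟨⟨fun lam mu h => ?_, fun x => ⟨_, recover x⟩⟩, ?_⟩
  · have hinit : (fun j : Fin m => lam j.castSucc) = fun j => mu j.castSucc := by
      rw [← consecutiveDiff_sum_Iic fun j => lam j.castSucc,
        ← consecutiveDiff_sum_Iic fun j => mu j.castSucc]
      congr 1
      ext i
      simpa only [init_eq] using congrFun h i.castSucc
    have hlast := congrFun h (Fin.last m)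
    simp only [last_eq, congrFun hinit, add_right_inj] at hlast
    ext i
    exact Fin.lastCases hlast (congrFun hinit) i
  · ext x
    constructor
    · rintro ⟨h0, hmono, hlast⟩
      refine ⟨fun j => Int.toNat (Fin.snoc (α := fun _ => ℤ)
        (consecutiveDiff fun i => x i.castSucc)
        (x (Fin.last m) - ∑ i, a i * x i.castSucc) j), ?_⟩
      conv_lhs => rw [← recover x]
      refine Finset.sum_congr rfl fun j _ => ?_
      rw [Int.toNat_of_nonneg]
      refine Fin.lastCases ?_ (fun i => ?_) j
      · simpa using hlast
      · simpa using consecutiveDiff_nonneg h0 hmono i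
    · rintro ⟨lam, rfl⟩
      simp only [Set.mem_ofPred_eq, init_eq, last_eq]
      refine ⟨fun i => by positivity, fun i j hij => ?_, by simp⟩
      exact Finset.sum_le_sum_of_subset_of_nonneg (Finset.Iic_subset_Iic.2 hij)
        fun _ _ _ => by positivity
end

section
/- Let n ≥ 2 and let a_1, …, a_{n−1} be integers with 0 ≤ a_1 ≤ a_2 ≤ … ≤ a_{n−1} and a_{n−1} ≥ 1. Set Σ_j := a_j + … + a_{n−1}; define b_j := e_j + e_{j+1} + … + e_{n−1} + Σ_j·e_n ∈ ℤ^n for 1 ≤ j ≤ n−1 and b_n := e_n. Let C := {x ∈ ℝ^n : ∀π ∈ S_{n−1}, ∀ε ∈ {±1}^{n−1}, ε_1a_1x_{π(1)} + … + ε_{n−1}a_{n−1}x_{π(n−1)} ≤ x_n}. Then the map from B_{n−1} × ℤ_{≥0}^n to C ∩ ℤ^n sending ((π,ε), λ) to the vector x defined by x_{π(i)} := ε_i·y_i for 1 ≤ i ≤ n−1 and x_n := y_n, where y := Σ_{j=1}^n (λ_j + [j ∈ D(π,ε)])·b_j (and [P] is 1 if P holds and 0 otherwise), is a bijection. -/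
/-- The entry `ε_j π(j)` (with `π` taking the values `1, …, p + 1`) of a signed permutation. -/
def signedEntry {p : ℕ} (π : Equiv.Perm (Fin (p + 1))) (ε : Fin (p + 1) → ℤˣ)
    (j : Fin (p + 1)) : ℤ :=
  (ε j : ℤ) * ((π j : ℕ) + 1)

/-- The indicator of the type B descent set of a signed permutation. -/
def descentIndicator {p : ℕ} (π : Equiv.Perm (Fin (p + 1))) (ε : Fin (p + 1) → ℤˣ) :
    Fin (p + 1) → ℤ :=
  Fin.cases (if signedEntry π ε 0 < 0 then 1 else 0)
    (fun i => if signedEntry π ε i.succ < signedEntry π ε i.castSucc then 1 else 0)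

/-- The sign of an integer, with `0` counted as positive. -/
def unitSign (z : ℤ) : ℤˣ := if z < 0 then -1 else 1

/-- Coordinates of `x` are sorted by absolute value, ties being broken by the signed index. -/
def sortKey {p : ℕ} (x : Fin (p + 1) → ℤ) (k : Fin (p + 1)) : ℤ ×ₗ ℤ :=
  toLex (|x k|, (unitSign (x k) : ℤ) * ((k : ℕ) + 1))

/-- `y` is nonnegative and weakly increasing, with strict inequalities at the descents. -/
def DescentCompatible {p : ℕ} (π : Equiv.Perm (Fin (p + 1))) (ε : Fin (p + 1) → ℤˣ)
    (y : Fin (p + 1) → ℤ) : Prop :=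
  descentIndicator π ε 0 ≤ y 0 ∧
    ∀ i : Fin p, descentIndicator π ε i.succ ≤ y i.succ - y i.castSucc

lemma unitSign_mul_abs (z : ℤ) : (unitSign z : ℤ) * |z| = z := by
  unfold unitSign
  split_ifs with h
  · simp [abs_of_neg h]
  · simp [abs_of_nonneg (not_lt.mp h)]

lemma signedEntry_ne_zero {p : ℕ} (π : Equiv.Perm (Fin (p + 1))) (ε : Fin (p + 1) → ℤˣ)
    (j : Fin (p + 1)) : signedEntry π ε j ≠ 0 :=
  mul_ne_zero (ε j).ne_zero (by positivity)

lemma signed_index_inj {p : ℕ} {u v : ℤˣ} {k l : Fin (p + 1)}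
    (h : (u : ℤ) * ((k : ℕ) + 1) = v * ((l : ℕ) + 1)) : k = l := by
  apply Fin.ext
  rcases Int.units_eq_one_or u with rfl | rfl <;> rcases Int.units_eq_one_or v with rfl | rfl <;>
    · simp only [Units.val_one, Units.val_neg] at h
      omega

lemma sortKey_injective {p : ℕ} (x : Fin (p + 1) → ℤ) : Function.Injective (sortKey x) := by
  intro k l h
  have h2 := congrArg (fun z => (ofLex z).2) h
  exact signed_index_inj h2

lemma signedEntry_injective {p : ℕ} (π : Equiv.Perm (Fin (p + 1))) (ε : Fin (p + 1) → ℤˣ) :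
    Function.Injective (signedEntry π ε) :=
  fun _ _ h => π.injective (signed_index_inj h)

lemma descentCompatible_iff {p : ℕ} (π : Equiv.Perm (Fin (p + 1))) (ε : Fin (p + 1) → ℤˣ)
    (y : Fin (p + 1) → ℤ) :
    DescentCompatible π ε y ↔
      StrictMono (fun i => toLex (y i, signedEntry π ε i)) ∧
        ∀ i, toLex ((0 : ℤ), (0 : ℤ)) < toLex (y i, signedEntry π ε i) := by
  have step : ∀ i : Fin p, descentIndicator π ε i.succ ≤ y i.succ - y i.castSucc ↔
      toLex (y i.castSucc, signedEntry π ε i.castSucc) <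
        toLex (y i.succ, signedEntry π ε i.succ) := by
    intro i
    have hne : signedEntry π ε i.castSucc ≠ signedEntry π ε i.succ := fun h =>
      Fin.castSucc_lt_succ.ne (signedEntry_injective π ε h)
    simp only [descentIndicator, Fin.cases_succ, Prod.Lex.toLex_lt_toLex]
    split_ifs <;> omega
  have zero : descentIndicator π ε 0 ≤ y 0 ↔
      toLex ((0 : ℤ), (0 : ℤ)) < toLex (y 0, signedEntry π ε 0) := by
    have hne := signedEntry_ne_zero π ε 0
    simp only [descentIndicator, Fin.cases_zero, Prod.Lex.toLex_lt_toLex]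
    split_ifs <;> omega
  rw [DescentCompatible, Fin.strictMono_iff_lt_succ, zero]
  simp only [step]
  refine ⟨fun ⟨h0, hs⟩ => ⟨hs, fun i => ?_⟩, fun ⟨hs, h0⟩ => ⟨h0 0, hs⟩⟩
  have hm : StrictMono (fun i => toLex (y i, signedEntry π ε i)) :=
    Fin.strictMono_iff_lt_succ.mpr hs
  exact h0.trans_le (hm.monotone (Fin.zero_le i))

lemma DescentCompatible.eq_sign_abs {p : ℕ} {π : Equiv.Perm (Fin (p + 1))}
    {ε : Fin (p + 1) → ℤˣ} {x y : Fin (p + 1) → ℤ} (h : DescentCompatible π ε y)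
    (hx : ∀ i, x (π i) = ε i * y i) (i : Fin (p + 1)) :
    ε i = unitSign (x (π i)) ∧ y i = |x (π i)| := by
  have hpos := ((descentCompatible_iff π ε y).mp h).2 i
  rw [Prod.Lex.toLex_lt_toLex, signedEntry] at hpos
  rw [hx i, unitSign]
  rcases Int.units_eq_one_or (ε i) with h1 | h1 <;>
    simp only [h1, Units.val_one, Units.val_neg] at hpos ⊢
  · have hy : 0 ≤ y i := by omega
    simp [hy, abs_of_nonneg hy]
  · have hy : 0 < y i := by omega
    simp [hy, abs_of_pos hy]

lemma DescentCompatible.strictMono_sortKey {p : ℕ} {π : Equiv.Perm (Fin (p + 1))}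
    {ε : Fin (p + 1) → ℤˣ} {x y : Fin (p + 1) → ℤ} (h : DescentCompatible π ε y)
    (hx : ∀ i, x (π i) = ε i * y i) : StrictMono (sortKey x ∘ π) := by
  convert ((descentCompatible_iff π ε y).mp h).1 using 1
  funext i
  obtain ⟨h1, h2⟩ := h.eq_sign_abs hx i
  simp [sortKey, signedEntry, h1, h2]

lemma DescentCompatible.unique {p : ℕ} {π π' : Equiv.Perm (Fin (p + 1))}
    {ε ε' : Fin (p + 1) → ℤˣ} {x y y' : Fin (p + 1) → ℤ} (h : DescentCompatible π ε y)
    (h' : DescentCompatible π' ε' y') (hx : ∀ i, x (π i) = ε i * y i)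
    (hx' : ∀ i, x (π' i) = ε' i * y' i) : π = π' ∧ ε = ε' ∧ y = y' := by
  have hcomp : sortKey x ∘ π = sortKey x ∘ π' := by
    refine ((h.strictMono_sortKey hx).range_inj (h'.strictMono_sortKey hx')).mp ?_
    rw [Set.range_comp, Set.range_comp, π.surjective.range_eq, π'.surjective.range_eq]
  obtain rfl : π = π' := Equiv.ext fun i => sortKey_injective x (congrFun hcomp i)
  refine ⟨rfl, funext fun i => ?_, funext fun i => ?_⟩
  · rw [(h.eq_sign_abs hx i).1, (h'.eq_sign_abs hx' i).1]
  · rw [(h.eq_sign_abs hx i).2, (h'.eq_sign_abs hx' i).2]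

lemma exists_descentCompatible {p : ℕ} (x : Fin (p + 1) → ℤ) :
    ∃ π ε y, DescentCompatible π ε y ∧ ∀ i, x (π i) = (ε i : ℤ) * y i := by
  refine ⟨Tuple.sort (sortKey x), fun i => unitSign (x (Tuple.sort (sortKey x) i)),
    fun i => |x (Tuple.sort (sortKey x) i)|, ?_, fun i => (unitSign_mul_abs _).symm⟩
  refine (descentCompatible_iff _ _ _).mpr ⟨?_, fun i => ?_⟩
  · exact (Tuple.monotone_sort (sortKey x)).strictMono_of_injective
      ((sortKey_injective x).comp (Tuple.sort (sortKey x)).injective)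
  · rw [Prod.Lex.toLex_lt_toLex]
    rcases eq_or_ne (x (Tuple.sort (sortKey x) i)) 0 with h0 | h0
    · refine Or.inr ⟨by simp [h0], ?_⟩
      simp only [signedEntry, unitSign, h0, lt_irrefl, if_false, Units.val_one, one_mul]
      positivity
    · exact Or.inl (abs_pos.mpr h0)

lemma DescentCompatible.nonneg {p : ℕ} {π : Equiv.Perm (Fin (p + 1))}
    {ε : Fin (p + 1) → ℤˣ} {y : Fin (p + 1) → ℤ} (h : DescentCompatible π ε y)
    (i : Fin (p + 1)) : 0 ≤ y i := by
  have := ((descentCompatible_iff π ε y).mp h).2 i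
  rw [Prod.Lex.toLex_lt_toLex] at this
  omega

lemma DescentCompatible.monotone {p : ℕ} {π : Equiv.Perm (Fin (p + 1))}
    {ε : Fin (p + 1) → ℤˣ} {y : Fin (p + 1) → ℤ} (h : DescentCompatible π ε y) :
    Monotone y := by
  intro i j hij
  have := ((descentCompatible_iff π ε y).mp h).1.monotone hij
  rw [Prod.Lex.toLex_le_toLex] at this
  omega

/-- The partial sums of a finite sequence. -/
def partialSum {p : ℕ} (c : Fin (p + 1) → ℤ) (i : Fin (p + 1)) : ℤ :=
  ∑ j, if j ≤ i then c j else 0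

lemma partialSum_zero {p : ℕ} (c : Fin (p + 1) → ℤ) : partialSum c 0 = c 0 := by
  simp [partialSum]

lemma partialSum_succ {p : ℕ} (c : Fin (p + 1) → ℤ) (i : Fin p) :
    partialSum c i.succ - partialSum c i.castSucc = c i.succ := by
  have hj : ∀ j : Fin (p + 1), (if j ≤ i.succ then c j else 0) -
      (if j ≤ i.castSucc then c j else 0) = if j = i.succ then c j else 0 := by
    intro j
    simp only [Fin.le_def, Fin.ext_iff, Fin.val_succ, Fin.val_castSucc]
    split_ifs <;> omega
  simp [partialSum, ← Finset.sum_sub_distrib, hj]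

lemma partialSum_eq {p : ℕ} {c y : Fin (p + 1) → ℤ} (h0 : c 0 = y 0)
    (hs : ∀ i : Fin p, c i.succ = y i.succ - y i.castSucc) : partialSum c = y := by
  funext i
  induction i using Fin.induction with
  | zero => rw [partialSum_zero, h0]
  | succ i ih =>
    have := partialSum_succ c i
    rw [hs, ih] at this
    linarith

lemma partialSum_injective {p : ℕ} :
    Function.Injective (partialSum : (Fin (p + 1) → ℤ) → Fin (p + 1) → ℤ) := by
  intro c c' h
  funext i
  cases i using Fin.cases with
  | zero => rw [← partialSum_zero c, h, partialSum_zero]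
  | succ i => rw [← partialSum_succ c, h, partialSum_succ]

lemma descentCompatible_partialSum {p : ℕ} (π : Equiv.Perm (Fin (p + 1)))
    (ε : Fin (p + 1) → ℤˣ) (l : Fin (p + 1) → ℕ) :
    DescentCompatible π ε (partialSum fun j => (l j : ℤ) + descentIndicator π ε j) := by
  refine ⟨?_, fun i => ?_⟩
  · rw [partialSum_zero]; omega
  · rw [partialSum_succ]; omega

lemma DescentCompatible.exists_partialSum {p : ℕ} {π : Equiv.Perm (Fin (p + 1))}
    {ε : Fin (p + 1) → ℤˣ} {y : Fin (p + 1) → ℤ} (h : DescentCompatible π ε y) :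
    ∃ l : Fin (p + 1) → ℕ,
      partialSum (fun j => (l j : ℤ) + descentIndicator π ε j) = y := by
  refine ⟨Fin.cases (y 0 - descentIndicator π ε 0).toNat
    fun i => (y i.succ - y i.castSucc - descentIndicator π ε i.succ).toNat,
    partialSum_eq ?_ fun i => ?_⟩
  · have := h.1
    simp only [Fin.cases_zero]
    omega
  · have := h.2 i
    simp only [Fin.cases_succ]
    omega

lemma units_mul_le_abs (u : ℤˣ) (z : ℤ) : (u : ℤ) * z ≤ |z| := by
  rcases Int.units_eq_one_or u with rfl | rfl
  · simpa using le_abs_self z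
  · simpa using neg_le_abs z

/-- The rearrangement inequality for signed permutations. -/
lemma sum_signed_perm_le {p : ℕ} {a : Fin (p + 1) → ℤ} (ha0 : ∀ i, 0 ≤ a i) (ha : Monotone a)
    {π : Equiv.Perm (Fin (p + 1))} {ε : Fin (p + 1) → ℤˣ} {x y : Fin (p + 1) → ℤ}
    (h : DescentCompatible π ε y) (hx : ∀ i, x (π i) = ε i * y i)
    (σ : Equiv.Perm (Fin (p + 1))) (η : Fin (p + 1) → ℤˣ) :
    ∑ i, (η i : ℤ) * a i * x (σ i) ≤ ∑ i, a i * y i := by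
  calc ∑ i, (η i : ℤ) * a i * x (σ i)
      ≤ ∑ i, a i * y ((σ.trans π.symm) i) := by
        refine Finset.sum_le_sum fun i _ => ?_
        have hy : y (π.symm (σ i)) = |x (σ i)| := by
          simpa using (h.eq_sign_abs hx (π.symm (σ i))).2
        rw [Equiv.trans_apply, hy, mul_comm (η i : ℤ), mul_assoc]
        exact mul_le_mul_of_nonneg_left (units_mul_le_abs _ _) (ha0 i)
    _ ≤ ∑ i, a i * y i := (ha.monovary h.monotone).sum_mul_comp_perm_le_sum_mul

theorem typeB_parameterization {p : ℕ} {a : Fin (p + 1) → ℤ} (ha0 : ∀ i, 0 ≤ a i)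
    (ha : Monotone a)
    (Φ : (Equiv.Perm (Fin (p + 1)) × (Fin (p + 1) → ℤˣ)) × (Fin (p + 2) → ℕ) →
      Fin (p + 2) → ℤ)
    (hinit : ∀ π ε lam i, Φ ((π, ε), lam) (π i).castSucc =
      ε i * partialSum (fun j => (lam j.castSucc : ℤ) + descentIndicator π ε j) i)
    (hlast : ∀ π ε lam, Φ ((π, ε), lam) (Fin.last (p + 1)) =
      ∑ i, a i * partialSum (fun j => (lam j.castSucc : ℤ) + descentIndicator π ε j) i +
        lam (Fin.last (p + 1))) :
    Function.Injective Φ ∧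
    Set.range Φ = {x : Fin (p + 2) → ℤ |
      ∀ (π : Equiv.Perm (Fin (p + 1))) (ε : Fin (p + 1) → ℤˣ),
        ∑ i, (ε i : ℤ) * a i * x (π i).castSucc ≤ x (Fin.last (p + 1))} := by
  constructor
  · rintro ⟨⟨π, ε⟩, lam⟩ ⟨⟨π', ε'⟩, lam'⟩ h
    obtain ⟨rfl, rfl, hy⟩ := (descentCompatible_partialSum π ε fun j => lam j.castSucc).unique
      (descentCompatible_partialSum π' ε' fun j => lam' j.castSucc)
      (x := fun k => Φ ((π, ε), lam) k.castSucc) (hinit π ε lam)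
      (fun i => by rw [h, hinit])
    have hl := congrFun h (Fin.last (p + 1))
    rw [hlast, hlast, hy, add_right_inj, Nat.cast_inj] at hl
    have hc := partialSum_injective hy
    congr 1
    funext j
    cases j using Fin.lastCases with
    | last => exact hl
    | cast j => simpa using congrFun hc j
  · ext x
    simp only [Set.mem_range, Set.mem_ofPred_eq]
    constructor
    · rintro ⟨⟨⟨π, ε⟩, lam⟩, rfl⟩ σ η
      rw [hlast]
      have := sum_signed_perm_le ha0 ha
        (descentCompatible_partialSum π ε fun j => lam j.castSucc)
        (x := fun k => Φ ((π, ε), lam) k.castSucc) (hinit π ε lam) σ η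
      linarith [Int.natCast_nonneg (lam (Fin.last (p + 1)))]
    · intro hC
      obtain ⟨π, ε, y, hcomp, hx⟩ := exists_descentCompatible fun k => x (Fin.castSucc k)
      obtain ⟨l, rfl⟩ := hcomp.exists_partialSum
      have hle := hC π ε
      simp only [hx] at hle
      have hsum : ∀ (i : Fin (p + 1)) (z : ℤ), (ε i : ℤ) * a i * (ε i * z) = a i * z := by
        intro i z
        rw [mul_mul_mul_comm, mul_comm (a i), ← mul_assoc, ← Units.val_mul,
          Int.units_mul_self, Units.val_one]
        ring
      simp only [hsum] at hle
      refine ⟨((π, ε), Fin.snoc l (x (Fin.last (p + 1)) - ∑ i, a i *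
        partialSum (fun j => (l j : ℤ) + descentIndicator π ε j) i).toNat), funext fun k => ?_⟩
      cases k using Fin.lastCases with
      | last =>
        rw [hlast]
        simp only [Fin.snoc_castSucc, Fin.snoc_last]
        omega
      | cast k =>
        obtain ⟨i, rfl⟩ := π.surjective k
        rw [hinit, hx]
        simp only [Fin.snoc_castSucc]

lemma sum_mul_tail_sum {p : ℕ} (a c : Fin (p + 1) → ℤ) :
    ∑ j, c j * ∑ i ∈ Finset.univ.filter (fun i : Fin (p + 1) => (j : ℕ) ≤ (i : ℕ)), a i =
      ∑ i, a i * partialSum c i := by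
  simp only [partialSum, Finset.mul_sum, Finset.sum_filter]
  rw [Finset.sum_comm]
  refine Finset.sum_congr rfl fun i _ => Finset.sum_congr rfl fun j _ => ?_
  simp only [Fin.le_def]
  split_ifs <;> ring

/-- type B bijective parameterization of the lattice points.
Indices are 0-based: the 0-based index `j` corresponds to the 1-based index
`j+1`. `S j = a_{j+1} + ⋯ + a_{n-1}` (1-based); `b` is the matrix of
generators of the fundamental cone (`b j = e_j + ⋯ + e_{n-2} + S j • e_{n-1}`
for `(j:ℕ) < n-1` and `b ⟨n-1⟩ = e_{n-1}`, 0-based coordinates);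
`val π ε j = ε_{j+1}·π(j+1)` encodes the signed one-line notation
(1-based value `(π j : ℕ) + 1`); `d π ε j` is the indicator that the
generator index `j` lies in the descent set `D(π,ε)`; and
`Φ ((π, ε), lam)` is the point `x` with `x_{π(i)} = ε_i y_i` (for the first
`n-1` coordinates) and `x_{n-1} = y_{n-1}`, where
`y = ∑_j (lam_j + d_j) b_j`. The map `Φ` is a bijection from
`B_{n-1} × ℤ_{≥0}ⁿ` onto `C ∩ ℤⁿ`. -/
theorem stmt_6 (n : ℕ) (hn : 2 ≤ n) (a : Fin (n - 1) → ℤ)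
    (ha0 : ∀ i, 0 ≤ a i) (ha : Monotone a) (halast : 1 ≤ a ⟨n - 2, by omega⟩)
    (S : ℕ → ℤ)
    (hS : ∀ j, S j = ∑ i ∈ Finset.univ.filter (fun i : Fin (n - 1) => j ≤ (i : ℕ)), a i)
    (b : Fin n → Fin n → ℤ)
    (hb : ∀ j i, b j i =
      if (j : ℕ) = n - 1 then (if (i : ℕ) = n - 1 then 1 else 0)
      else if (i : ℕ) = n - 1 then S (j : ℕ)
      else if (j : ℕ) ≤ (i : ℕ) then 1 else 0)
    (val : Equiv.Perm (Fin (n - 1)) → (Fin (n - 1) → ℤˣ) → Fin (n - 1) → ℤ)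
    (hval : ∀ π ε j, val π ε j = (ε j : ℤ) * ((π j : ℕ) + 1))
    (d : Equiv.Perm (Fin (n - 1)) → (Fin (n - 1) → ℤˣ) → Fin n → ℤ)
    (hd : ∀ π ε j, d π ε j =
      if h : (j : ℕ) < n - 1 then
        (if hj : (j : ℕ) = 0 then (if val π ε ⟨0, by omega⟩ < 0 then 1 else 0)
         else (if val π ε ⟨(j : ℕ), h⟩ < val π ε ⟨(j : ℕ) - 1, by omega⟩ then 1 else 0))
      else 0)
    (Φ : (Equiv.Perm (Fin (n - 1)) × (Fin (n - 1) → ℤˣ)) × (Fin n → ℕ) → Fin n → ℤ)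
    (hΦ : ∀ π ε lam k, Φ ((π, ε), lam) k =
      if h : (k : ℕ) < n - 1 then
        (ε (π.symm ⟨(k : ℕ), h⟩) : ℤ) *
          ∑ j, ((lam j : ℤ) + d π ε j) * b j (Fin.castLE (by omega) (π.symm ⟨(k : ℕ), h⟩))
      else ∑ j, ((lam j : ℤ) + d π ε j) * b j ⟨n - 1, by omega⟩) :
    Function.Injective Φ ∧
    Set.range Φ = {x : Fin n → ℤ |
      ∀ (π : Equiv.Perm (Fin (n - 1))) (ε : Fin (n - 1) → ℤˣ),
        ∑ i, (ε i : ℤ) * a i * x (Fin.castLE (by omega) (π i)) ≤ x ⟨n - 1, by omega⟩} := by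
  obtain ⟨p, rfl⟩ : ∃ p, n = p + 2 := ⟨n - 2, by omega⟩
  have hdc : ∀ (π : Equiv.Perm (Fin (p + 1))) (ε : Fin (p + 1) → ℤˣ) (j : Fin (p + 1)),
      d π ε j.castSucc = descentIndicator π ε j := by
    intro π ε j
    have hv : ∀ j, val π ε j = signedEntry π ε j := hval π ε
    rw [hd, dif_pos (show ((j.castSucc : Fin (p + 2)) : ℕ) < p + 2 - 1 from j.isLt)]
    cases j using Fin.cases with
    | zero =>
      rw [dif_pos (by simp), hv]
      rfl
    | succ i =>
      rw [dif_neg (by simp), hv, hv]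
      rfl
  have hdl : ∀ (π : Equiv.Perm (Fin (p + 1))) (ε : Fin (p + 1) → ℤˣ),
      d π ε (Fin.last (p + 1)) = 0 := by
    intro π ε
    rw [hd, dif_neg (by simp)]
  have hbcc : ∀ j i : Fin (p + 1), b j.castSucc i.castSucc = if j ≤ i then 1 else 0 := by
    intro j i
    have hj := j.isLt
    have hi := i.isLt
    rw [hb, if_neg (by simp; omega), if_neg (by simp; omega)]
    rfl
  have hblc : ∀ i : Fin (p + 1), b (Fin.last (p + 1)) i.castSucc = 0 := by
    intro i
    have hi := i.isLt
    rw [hb, if_pos (by simp), if_neg (by simp; omega)]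
  have hbcl : ∀ j : Fin (p + 1), b j.castSucc (Fin.last (p + 1)) = S j := by
    intro j
    have hj := j.isLt
    rw [hb, if_neg (by simp; omega), if_pos (by simp)]
    rfl
  have hbll : b (Fin.last (p + 1)) (Fin.last (p + 1)) = 1 := by
    rw [hb, if_pos (by simp), if_pos (by simp)]
  refine typeB_parameterization (p := p) ha0 ha Φ (fun π ε lam i => ?_) fun π ε lam => ?_
  · have h := hΦ π ε lam (π i).castSucc
    rw [dif_pos (show (((π i).castSucc : Fin (p + 2)) : ℕ) < p + 2 - 1 from (π i).isLt)] at h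
    have hi : π.symm ⟨((π i).castSucc : Fin (p + 2)), (π i).isLt⟩ = i := π.symm_apply_apply i
    refine h.trans ?_
    have key : ∑ j, ((lam j : ℤ) + d π ε j) * b j i.castSucc =
        partialSum (fun j => (lam j.castSucc : ℤ) + descentIndicator π ε j) i := by
      rw [Fin.sum_univ_castSucc]
      simp only [hblc, hbcc, hdc, partialSum, mul_ite, mul_one, mul_zero, add_zero]
    rw [← key]
    exact congrArg (fun k : Fin (p + 1) =>
      (ε k : ℤ) * ∑ j, ((lam j : ℤ) + d π ε j) * b j k.castSucc) hi
  · have h := hΦ π ε lam (Fin.last (p + 1))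
    rw [dif_neg (by simp)] at h
    refine h.trans ?_
    change ∑ j, ((lam j : ℤ) + d π ε j) * b j (Fin.last (p + 1)) = _
    rw [Fin.sum_univ_castSucc, hbll, hdl, ← sum_mul_tail_sum]
    simp only [hbcl, hdc, hS, add_zero, mul_one]
    rfl
end

section
/- Let n ≥ 2. Then the following identity of polynomials holds in ℤ[t]: Σ_{(π,ε) ∈ B_{n−1}} t^{comaj(π,ε)} = (1+t)^{n−1} · [n−1]_t!. -/
/-- The sum of the values `m - j` over the descent positions `j` of the word `w`, where the
letter preceding `w 0` is taken to be `x`. -/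
def comajFrom {α : Type*} [LinearOrder α] {m : ℕ} (x : α) (w : Fin m → α) : ℕ :=
  ∑ j : Fin m, (if w j < (Fin.cons x w : Fin (m + 1) → α) j.castSucc then 1 else 0) * (m - (j : ℕ))

theorem comajFrom_succ {α : Type*} [LinearOrder α] {m : ℕ} (x : α) (w : Fin (m + 1) → α) :
    comajFrom x w = (if w 0 < x then m + 1 else 0) + comajFrom (w 0) (Fin.tail w) := by
  unfold comajFrom
  rw [Fin.sum_univ_succ, Fin.cons_self_tail]
  congr 1
  · simp
  · refine Finset.sum_congr rfl fun j _ => ?_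
    rw [← Fin.succ_castSucc, Fin.cons_succ]
    simp only [Fin.val_succ, Nat.add_sub_add_right, Fin.tail]
    rfl

section rank

variable {α : Type*} [LinearOrder α] {ι : Type*} [Fintype ι]

theorem card_filter_lt_lt_iff (f : ι → α) (x : α) (p : ι) :
    (Finset.univ.filter fun v => f v < f p).card < (Finset.univ.filter fun v => f v < x).card ↔
      f p < x := by
  constructor
  · intro h
    by_contra! hx
    refine h.not_ge (Finset.card_le_card fun v hv => ?_)
    simp only [Finset.mem_filter, Finset.mem_univ, true_and] at hv ⊢
    exact hv.trans_le hx
  · intro h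
    refine Finset.card_lt_card (Finset.ssubset_iff_of_subset (fun v hv => ?_) |>.2 ⟨p, ?_, ?_⟩)
    · simp only [Finset.mem_filter, Finset.mem_univ, true_and] at hv ⊢
      exact hv.trans h
    · simpa using h
    · simp

theorem sum_card_filter_lt {M : Type*} [AddCommMonoid M] {f : ι → α} (hf : Function.Injective f)
    (g : ℕ → M) :
    ∑ p, g (Finset.univ.filter fun v => f v < f p).card = ∑ s ∈ Finset.range (Fintype.card ι), g s := by
  have hinj : Function.Injective fun p => (Finset.univ.filter fun v => f v < f p).card := by
    intro p q h
    apply hf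
    apply le_antisymm <;> by_contra! hlt <;>
      have := (card_filter_lt_lt_iff f _ _).2 hlt <;> simp only at h <;> omega
  have himage : Finset.univ.image (fun p => (Finset.univ.filter fun v => f v < f p).card) =
      Finset.range (Fintype.card ι) := by
    apply Finset.eq_of_subset_of_card_le
    · intro s hs
      obtain ⟨p, -, rfl⟩ := Finset.mem_image.1 hs
      refine Finset.mem_range.2 (Finset.card_lt_univ_of_notMem (x := p) ?_)
      simp
    · rw [Finset.card_image_of_injective _ hinj]
      simp
  rw [← himage, Finset.sum_image hinj.injOn]

end rank

theorem sum_range_ite_pow {R : Type*} [CommSemiring R] (t : R) {m r : ℕ} (hr : r ≤ m) :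
    ∑ s ∈ Finset.range m, t ^ ((if s < r then m else 0) + s) =
      t ^ r * ∑ s ∈ Finset.range m, t ^ s := by
  obtain ⟨k, rfl⟩ := Nat.exists_eq_add_of_le hr
  rw [Finset.sum_range_add, Nat.add_comm r k, Finset.sum_range_add, mul_add, add_comm,
    Finset.mul_sum, Finset.mul_sum]
  congr 1
  · refine Finset.sum_congr rfl fun s _ => ?_
    simp [pow_add]
  · refine Finset.sum_congr rfl fun s hs => ?_
    rw [if_pos (Finset.mem_range.1 hs)]
    ring

theorem sum_perm_pow_comajFrom {α : Type*} [LinearOrder α] {R : Type*} [CommSemiring R] (t : R)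
    {m : ℕ} (f : Fin m → α) (hf : Function.Injective f) (x : α) :
    ∑ π : Equiv.Perm (Fin m), t ^ comajFrom x (f ∘ π) =
      t ^ (Finset.univ.filter fun v => f v < x).card *
        ∏ k ∈ Finset.range m, ∑ i ∈ Finset.range (k + 1), t ^ i := by
  induction m generalizing x with
  | zero => simp [comajFrom]
  | succ m ih =>
    have hrest (p : Fin (m + 1)) :
        ∑ e : Equiv.Perm (Fin m), t ^ comajFrom x (f ∘ Equiv.Perm.decomposeFin.symm (p, e)) =
          t ^ ((if f p < x then m + 1 else 0) + (Finset.univ.filter fun v => f v < f p).card) *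
            ∏ k ∈ Finset.range m, ∑ i ∈ Finset.range (k + 1), t ^ i := by
      have hinj : Function.Injective fun i : Fin m => f (Equiv.swap 0 p i.succ) :=
        hf.comp ((Equiv.injective _).comp (Fin.succ_injective m))
      have hcard : (Finset.univ.filter fun i : Fin m => f (Equiv.swap 0 p i.succ) < f p).card =
          (Finset.univ.filter fun v => f v < f p).card := by
        simp only [Finset.card_filter]
        rw [← Equiv.sum_comp (Equiv.swap 0 p) (fun v => if f v < f p then 1 else 0),
          Fin.sum_univ_succ]
        simp
      rw [pow_add, mul_assoc, ← hcard, ← ih _ hinj (f p), Finset.mul_sum]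
      refine Finset.sum_congr rfl fun e _ => ?_
      have htail : Fin.tail (f ∘ Equiv.Perm.decomposeFin.symm (p, e)) =
          (fun i : Fin m => f (Equiv.swap 0 p i.succ)) ∘ e := by
        ext i
        simp [Fin.tail]
      rw [comajFrom_succ, htail, pow_add]
      simp
    have hr : (Finset.univ.filter fun v => f v < x).card ≤ m + 1 := by
      simpa using Finset.card_le_univ (Finset.univ.filter fun v => f v < x)
    rw [← Equiv.sum_comp Equiv.Perm.decomposeFin.symm, Fintype.sum_prod_type,
      Finset.sum_congr rfl fun p _ => hrest p, ← Finset.sum_mul,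
      Finset.sum_congr rfl fun p _ => by rw [← if_congr (card_filter_lt_lt_iff f x p) rfl rfl],
      sum_card_filter_lt hf (fun s =>
      t ^ ((if s < (Finset.univ.filter fun v => f v < x).card then m + 1 else 0) + s)),
      Fintype.card_fin, sum_range_ite_pow t hr, Finset.prod_range_succ]
    ring

theorem sum_signs_pow_card_neg {R : Type*} [CommSemiring R] (t : R) {ι : Type*} [Fintype ι]
    [DecidableEq ι] :
    ∑ η : ι → ℤˣ, t ^ (Finset.univ.filter fun v => (η v : ℤ) < 0).card =
      (1 + t) ^ Fintype.card ι := by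
  have hsum : ∑ u : ℤˣ, (if (u : ℤ) < 0 then t else 1) = 1 + t := by
    rw [show (Finset.univ : Finset ℤˣ) = {1, -1} from rfl, Finset.sum_pair (by decide)]
    simp
  rw [← hsum, ← Finset.card_univ, ← Finset.prod_const, Finset.prod_univ_sum,
    Fintype.piFinset_univ]
  refine Finset.sum_congr rfl fun η _ => ?_
  rw [Finset.prod_ite]
  simp

theorem injective_sign_mul_succ {m : ℕ} (η : Fin m → ℤˣ) :
    Function.Injective fun v : Fin m => (η v : ℤ) * ((v : ℕ) + 1) := by
  intro a b h
  have := congrArg Int.natAbs h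
  simp only [Int.natAbs_mul, Int.units_natAbs, one_mul] at this
  omega


/-- distribution of the comajor index on the hyperoctahedral
group. Positions are 0-based: the 0-based position `j` corresponds to the
1-based position `j+1`, and `val π ε j = ε_{j+1}·π(j+1)` encodes the signed
one-line notation (1-based value `(π j : ℕ) + 1`). `d π ε j` is the indicator
that `j` is a descent position of `(π,ε) ∈ B_{n-1}`; the comajor index is
`comaj(π,ε) = Σ_{j ∈ D(π,ε)} (n - j)` (1-based), i.e.
`∑ j, d π ε j * (n - 1 - j)` in 0-based positions. The identity
`Σ_{(π,ε) ∈ B_{n-1}} t^{comaj(π,ε)} = (1+t)^{n-1} [n-1]_t!`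
holds in `ℤ[t]`. -/
theorem stmt_9 (n : ℕ) (hn : 2 ≤ n)
    (val : Equiv.Perm (Fin (n - 1)) → (Fin (n - 1) → ℤˣ) → Fin (n - 1) → ℤ)
    (hval : ∀ π ε j, val π ε j = (ε j : ℤ) * ((π j : ℕ) + 1))
    (d : Equiv.Perm (Fin (n - 1)) → (Fin (n - 1) → ℤˣ) → Fin (n - 1) → ℕ)
    (hd : ∀ π ε j, d π ε j =
      if (j : ℕ) = 0 then (if val π ε j < 0 then 1 else 0)
      else (if val π ε j < val π ε ⟨(j : ℕ) - 1, by omega⟩ then 1 else 0)) :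
    ∑ π : Equiv.Perm (Fin (n - 1)), ∑ ε : Fin (n - 1) → ℤˣ,
        (Polynomial.X : Polynomial ℤ) ^ (∑ j : Fin (n - 1), d π ε j * (n - 1 - (j : ℕ))) =
      (1 + Polynomial.X) ^ (n - 1) *
        ∏ k ∈ Finset.range (n - 1), (∑ i ∈ Finset.range (k + 1), (Polynomial.X : Polynomial ℤ) ^ i) := by
  have hcomaj (π : Equiv.Perm (Fin (n - 1))) (η : Fin (n - 1) → ℤˣ) :
      ∑ j : Fin (n - 1), d π (η ∘ π) j * (n - 1 - (j : ℕ)) =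
        comajFrom (0 : ℤ) ((fun v : Fin (n - 1) => (η v : ℤ) * ((v : ℕ) + 1)) ∘ π) := by
    refine Finset.sum_congr rfl fun j _ => ?_
    rw [hd]
    congr 1
    obtain ⟨j, hj⟩ := j
    cases j with
    | zero => simp [hval]
    | succ j =>
      have hcast : (⟨j + 1, hj⟩ : Fin (n - 1)).castSucc = Fin.succ ⟨j, by omega⟩ := rfl
      rw [hcast, Fin.cons_succ]
      simp [hval]
  have hreindex (π : Equiv.Perm (Fin (n - 1))) :
      ∑ ε : Fin (n - 1) → ℤˣ,
          (Polynomial.X : Polynomial ℤ) ^ (∑ j : Fin (n - 1), d π ε j * (n - 1 - (j : ℕ))) =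
        ∑ η : Fin (n - 1) → ℤˣ, (Polynomial.X : Polynomial ℤ) ^
          comajFrom (0 : ℤ) ((fun v : Fin (n - 1) => (η v : ℤ) * ((v : ℕ) + 1)) ∘ π) := by
    rw [← Equiv.sum_comp (Equiv.arrowCongr π.symm (Equiv.refl ℤˣ))]
    refine Finset.sum_congr rfl fun η _ => ?_
    rw [← hcomaj]
    rfl
  have hneg (η : Fin (n - 1) → ℤˣ) (v : Fin (n - 1)) :
      (η v : ℤ) * ((v : ℕ) + 1) < 0 ↔ (η v : ℤ) < 0 :=
    by
    rw [Int.mul_neg_iff]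
    omega
  rw [Finset.sum_congr rfl fun π _ => hreindex π, Finset.sum_comm]
  simp only [sum_perm_pow_comajFrom _ _ (injective_sign_mul_succ _), hneg]
  rw [← Finset.sum_mul, sum_signs_pow_card_neg, Fintype.card_fin]
end

section
/- Let n ≥ 2 and let c ≥ 1 be an integer. Then the following identity holds in the formal power series ring ℤ[[t]]: (1 − t^c)^n · Σ_{k≥0} #{x ∈ ℤ^{n−1} : c(|x_1| + … + |x_{n−1}|) ≤ k} · t^k = [c]_t · (1 + t^c)^{n−1}. -/
/-- The points `(a, y)` of `ℤ × α` with `c (|a| + s y) ≤ k` are finitely many if this holds for the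
sublevel sets of `c * s`. -/
theorem finite_natAbs_add_le {α : Type*} (s : α → ℕ) {c : ℕ} (hc : 1 ≤ c)
    (hfin : ∀ k, {y | c * s y ≤ k}.Finite) (k : ℕ) :
    {p : ℤ × α | c * (p.1.natAbs + s p.2) ≤ k}.Finite := by
  refine ((Set.finite_Icc (-(k : ℤ)) k).prod (hfin k)).subset ?_
  rintro ⟨a, y⟩ h
  simp only [Set.mem_ofPred_eq, Set.mem_prod, Set.mem_Icc, mul_add] at h ⊢
  have : a.natAbs ≤ c * a.natAbs := Nat.le_mul_of_pos_left _ hc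
  omega

/-- Below level `c` only the slice `a = 0` contributes. -/
theorem ncard_natAbs_add_le_of_lt {α : Type*} (s : α → ℕ) {c k : ℕ} (hk : k < c) :
    {p : ℤ × α | c * (p.1.natAbs + s p.2) ≤ k}.ncard = {y | c * s y ≤ k}.ncard := by
  rw [← Set.ncard_image_of_injective {y | c * s y ≤ k} (Prod.mk_right_injective (0 : ℤ))]
  refine congrArg Set.ncard (Set.ext ?_)
  rintro ⟨a, y⟩
  simp only [Set.mem_ofPred_eq, Set.mem_image, Prod.mk.injEq]
  constructor
  · intro h
    have ha : a = 0 := by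
      by_contra ha
      have : c * 1 ≤ c * (a.natAbs + s y) := Nat.mul_le_mul_left c (by omega)
      omega
    subst ha
    exact ⟨y, by simpa using h, rfl, rfl⟩
  · rintro ⟨z, hz, rfl, rfl⟩
    simpa using hz

/-- Raising the level by `c`: the parts `a > 0` and `a < 0` are shifted copies of the parts
`a ≥ 0` and `a ≤ 0` of the previous level. -/
theorem ncard_natAbs_add_le_add {α : Type*} (s : α → ℕ) {c : ℕ} (hc : 1 ≤ c)
    (hfin : ∀ k, {y | c * s y ≤ k}.Finite) (k : ℕ) :
    {p : ℤ × α | c * (p.1.natAbs + s p.2) ≤ k + c}.ncard =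
      {p : ℤ × α | c * (p.1.natAbs + s p.2) ≤ k}.ncard +
        {y | c * s y ≤ k + c}.ncard + {y | c * s y ≤ k}.ncard := by
  set T : ℕ → Set (ℤ × α) := fun k => {p | c * (p.1.natAbs + s p.2) ≤ k} with hT
  have hTfin : ∀ k, (T k).Finite := finite_natAbs_add_le s hc hfin
  set P : Set (ℤ × α) := {p | p ∈ T k ∧ 0 ≤ p.1} with hP
  set N : Set (ℤ × α) := {p | p ∈ T k ∧ p.1 ≤ 0} with hN
  have hPfin : P.Finite := (hTfin k).subset fun p hp => hp.1
  have hNfin : N.Finite := (hTfin k).subset fun p hp => hp.1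
  have slice (k : ℕ) : (Prod.mk (0 : ℤ) '' {y | c * s y ≤ k}).ncard = {y | c * s y ≤ k}.ncard :=
    Set.ncard_image_of_injective _ (Prod.mk_right_injective (0 : ℤ))
  have hunion : P ∪ N = T k := by
    ext p
    simp only [hP, hN, Set.mem_union, Set.mem_ofPred_eq]
    have := le_total 0 p.1
    tauto
  have hinter : P ∩ N = Prod.mk (0 : ℤ) '' {y | c * s y ≤ k} := by
    ext ⟨a, y⟩
    simp only [hP, hN, hT, Set.mem_inter_iff, Set.mem_ofPred_eq, Set.mem_image, Prod.mk.injEq]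
    constructor
    · rintro ⟨⟨h, h0⟩, -, h1⟩
      obtain rfl : a = 0 := le_antisymm h1 h0
      exact ⟨y, by simpa using h, rfl, rfl⟩
    · rintro ⟨z, hz, rfl, rfl⟩
      simpa using hz
  have hPN := Set.ncard_union_add_ncard_inter P N hPfin hNfin
  rw [hunion, hinter, slice] at hPN
  have hup : Function.Injective fun p : ℤ × α => (p.1 + 1, p.2) := by
    rintro ⟨a, y⟩ ⟨b, z⟩ h
    simpa using h
  have hdown : Function.Injective fun p : ℤ × α => (p.1 - 1, p.2) := by
    rintro ⟨a, y⟩ ⟨b, z⟩ h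
    simpa using h
  have hsplit : T (k + c) = Prod.mk (0 : ℤ) '' {y | c * s y ≤ k + c} ∪
      ((fun p : ℤ × α => (p.1 + 1, p.2)) '' P ∪ (fun p : ℤ × α => (p.1 - 1, p.2)) '' N) := by
    ext ⟨a, y⟩
    simp only [hP, hN, hT, Set.mem_union, Set.mem_ofPred_eq, Set.mem_image, Prod.mk.injEq,
      Prod.exists]
    constructor
    · intro h
      rcases lt_trichotomy a 0 with ha | rfl | ha
      · refine Or.inr (Or.inr ⟨a + 1, y, ⟨?_, by omega⟩, by omega, rfl⟩)
        rw [show a.natAbs + s y = (a + 1).natAbs + s y + 1 by omega, mul_add_one] at h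
        omega
      · exact Or.inl ⟨y, by simpa using h, rfl, rfl⟩
      · refine Or.inr (Or.inl ⟨a - 1, y, ⟨?_, by omega⟩, by omega, rfl⟩)
        rw [show a.natAbs + s y = (a - 1).natAbs + s y + 1 by omega, mul_add_one] at h
        omega
    · rintro (⟨z, hz, rfl, rfl⟩ | ⟨b, z, ⟨h, hb⟩, rfl, rfl⟩ | ⟨b, z, ⟨h, hb⟩, rfl, rfl⟩)
      · simpa using hz
      · rw [show (b + 1).natAbs + s z = b.natAbs + s z + 1 by omega, mul_add_one]
        omega
      · rw [show (b - 1).natAbs + s z = b.natAbs + s z + 1 by omega, mul_add_one]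
        omega
  have hdisj : Disjoint ((fun p : ℤ × α => (p.1 + 1, p.2)) '' P)
      ((fun p : ℤ × α => (p.1 - 1, p.2)) '' N) := by
    rw [Set.disjoint_left]
    rintro _ ⟨p, hp, rfl⟩ ⟨q, hq, h⟩
    have h1 : q.1 - 1 = p.1 + 1 := congrArg Prod.fst h
    have h2 : 0 ≤ p.1 := hp.2
    have h3 : q.1 ≤ 0 := hq.2
    omega
  have hdisj0 : Disjoint (Prod.mk (0 : ℤ) '' {y | c * s y ≤ k + c})
      ((fun p : ℤ × α => (p.1 + 1, p.2)) '' P ∪ (fun p : ℤ × α => (p.1 - 1, p.2)) '' N) := by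
    rw [Set.disjoint_left]
    rintro _ ⟨y, -, rfl⟩ (⟨q, hq, h⟩ | ⟨q, hq, h⟩)
    · have h1 : q.1 + 1 = 0 := congrArg Prod.fst h
      have h2 : 0 ≤ q.1 := hq.2
      omega
    · have h1 : q.1 - 1 = 0 := congrArg Prod.fst h
      have h2 : q.1 ≤ 0 := hq.2
      omega
  change (T (k + c)).ncard = (T k).ncard + _ + _
  rw [hsplit, Set.ncard_union_eq hdisj0 ((hfin _).image _) ((hPfin.image _).union (hNfin.image _)),
    Set.ncard_union_eq hdisj (hPfin.image _) (hNfin.image _), slice,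
    Set.ncard_image_of_injective _ hup, Set.ncard_image_of_injective _ hdown]
  omega

/-- The set of points of `ℤ^(m+1)` in a cross-polytope, with the first coordinate split off. -/
theorem image_cons_natAbs_sum_le (m c k : ℕ) :
    {x : Fin (m + 1) → ℤ | c * ∑ i, (x i).natAbs ≤ k} =
      Fin.consEquiv (fun _ => ℤ) ''
        {p : ℤ × (Fin m → ℤ) | c * (p.1.natAbs + ∑ i, (p.2 i).natAbs) ≤ k} := by
  ext x
  rw [Equiv.image_eq_preimage_symm]
  simp [Fin.consEquiv, Fin.sum_univ_succ, Fin.tail]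

theorem finite_sum_natAbs_le {c : ℕ} (hc : 1 ≤ c) (m k : ℕ) :
    {x : Fin m → ℤ | c * ∑ i, (x i).natAbs ≤ k}.Finite := by
  induction m generalizing k with
  | zero => exact Set.toFinite _
  | succ m ih =>
    rw [image_cons_natAbs_sum_le]
    exact (finite_natAbs_add_le _ hc ih k).image _

/-- The Ehrhart series of the cross-polytope of dimension `m` dilated by `1 / c`. -/
noncomputable def crossPolytopeSeries (c m : ℕ) : PowerSeries ℤ :=
  PowerSeries.mk fun k => ({x : Fin m → ℤ | c * ∑ i, (x i).natAbs ≤ k}.ncard : ℤ)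

theorem one_sub_X_mul_crossPolytopeSeries_zero (c : ℕ) :
    (1 - PowerSeries.X) * crossPolytopeSeries c 0 = 1 := by
  have : crossPolytopeSeries c 0 = PowerSeries.mk 1 := by
    ext k
    simp [crossPolytopeSeries, Set.ofPred_true, Set.ncard_univ]
  rw [this, mul_comm, PowerSeries.mk_one_mul_one_sub_eq_one]

theorem one_sub_X_pow_mul_crossPolytopeSeries_succ {c : ℕ} (hc : 1 ≤ c) (m : ℕ) :
    (1 - PowerSeries.X ^ c) * crossPolytopeSeries c (m + 1) =
      (1 + PowerSeries.X ^ c) * crossPolytopeSeries c m := by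
  ext k
  simp only [sub_mul, add_mul, one_mul, map_sub, map_add, PowerSeries.coeff_X_pow_mul',
    crossPolytopeSeries, PowerSeries.coeff_mk, image_cons_natAbs_sum_le,
    Set.ncard_image_of_injective _ (Equiv.injective _)]
  split_ifs with h
  · obtain ⟨j, rfl⟩ := Nat.exists_eq_add_of_le' h
    rw [Nat.add_sub_cancel, ncard_natAbs_add_le_add (fun y : Fin m → ℤ => ∑ i, (y i).natAbs) hc
      (finite_sum_natAbs_le hc m)]
    push_cast
    ring
  · rw [ncard_natAbs_add_le_of_lt (fun y : Fin m → ℤ => ∑ i, (y i).natAbs) (not_le.mp h)]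
    simp

theorem one_sub_X_pow_pow_mul_crossPolytopeSeries {c : ℕ} (hc : 1 ≤ c) (m : ℕ) :
    (1 - PowerSeries.X ^ c) ^ (m + 1) * crossPolytopeSeries c m =
      (∑ i ∈ Finset.range c, (PowerSeries.X : PowerSeries ℤ) ^ i) *
        (1 + PowerSeries.X ^ c) ^ m := by
  induction m with
  | zero =>
    rw [zero_add, pow_one, pow_zero, mul_one, ← geom_sum_mul_neg, mul_assoc,
      one_sub_X_mul_crossPolytopeSeries_zero, mul_one]
  | succ m ih =>
    rw [pow_succ, mul_assoc, one_sub_X_pow_mul_crossPolytopeSeries_succ hc, mul_left_comm, ih]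
    ring

/-- Ehrhart series of the dilated cross-polytope, the case
`b = 0`. `A k` is the set of integer points `x ∈ ℤ^{n-1}` with
`c(|x_1| + ⋯ + |x_{n-1}|) ≤ k`. The identity
`(1 - t^c)^n · Σ_{k≥0} #A(k) t^k = [c]_t (1 + t^c)^{n-1}` holds in `ℤ[[t]]`. -/
theorem stmt_10 (n : ℕ) (hn : 2 ≤ n) (c : ℕ) (hc : 1 ≤ c)
    (A : ℕ → Set (Fin (n - 1) → ℤ))
    (hA : ∀ k, A k = {x | c * ∑ i, (x i).natAbs ≤ k}) :
    (∀ k, (A k).Finite) ∧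
    (1 - PowerSeries.X ^ c) ^ n * PowerSeries.mk (fun k => (Nat.card (A k) : ℤ)) =
      (∑ i ∈ Finset.range c, (PowerSeries.X : PowerSeries ℤ) ^ i) *
        (1 + PowerSeries.X ^ c) ^ (n - 1) := by
  obtain rfl : A = fun k => {x | c * ∑ i, (x i).natAbs ≤ k} := funext hA
  obtain ⟨m, rfl⟩ : ∃ m, n = m + 1 := ⟨n - 1, by omega⟩
  exact ⟨finite_sum_natAbs_le hc _, one_sub_X_pow_pow_mul_crossPolytopeSeries hc m⟩
end

section
/- Let n ≥ 3 and let d ≥ 0, c ≥ −2d, b ≥ 0 be integers, not all three zero. Define a_i := 2di + c for 1 ≤ i ≤ n−2 and a_{n−1} := 2d(n−1) + c + b. Then for every integer m ≥ 0: #{λ ∈ L_{n−1} : Σ_{i=1}^{n−1} a_i·⌈λ_i/(2i)⌉ ≤ m} = #{x ∈ ℤ^{n−1} : ∀π ∈ S_{n−1}, ∀ε ∈ {±1}^{n−1}, ε_1a_1x_{π(1)} + … + ε_{n−1}a_{n−1}x_{π(n−1)} ≤ m}, both sets being finite. Equivalently, the generating function f_C(t) = Σ_{m≥0} N(m) t^m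 of the type-B symmetrically constrained cone with these coefficients a_i equals (1/(1−t)) · Σ_{λ ∈ L_{n−1}} t^{Σ_{i=1}^{n−1} a_i ⌈λ_i/(2i)⌉}. -/
/-- `IsLectureHall q l` says that `l 0 / 1 ≤ l 1 / 2 ≤ … ≤ l (q - 1) / q`. -/
def IsLectureHall (q : ℕ) (l : ℕ → ℕ) : Prop :=
  ∀ i, i + 1 < q → l i * (i + 2) ≤ l (i + 1) * (i + 1)

/-- The ceiling of `l i / (i + 1)`. -/
def ceilRatio (l : ℕ → ℕ) (i : ℕ) : ℕ := (l i + i) / (i + 1)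

/-- The defect `j` in `l i = ceilRatio l i * (i + 1) - j`. -/
def ceilDefect (l : ℕ → ℕ) (i : ℕ) : ℕ := ceilRatio l i * (i + 1) - l i

theorem add_ceilDefect (l : ℕ → ℕ) (i : ℕ) : l i + ceilDefect l i = ceilRatio l i * (i + 1) := by
  have h := Nat.lt_div_mul_add (a := l i + i) (b := i + 1) (by omega)
  unfold ceilDefect ceilRatio
  omega

theorem ceilDefect_lt (l : ℕ → ℕ) (i : ℕ) : ceilDefect l i < i + 1 := by
  have h := Nat.div_mul_le_self (l i + i) (i + 1)
  unfold ceilDefect ceilRatio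
  omega

theorem ceilRatio_eq {l : ℕ → ℕ} {i M j : ℕ} (hj : j < i + 1) (h : l i + j = M * (i + 1)) :
    ceilRatio l i = M := by
  unfold ceilRatio
  rw [Nat.div_eq_iff (by omega)]
  constructor
  · omega
  · omega

/-- Encodes a lecture hall partition as a sequence of natural numbers: the ceilings are inserted
one after another, each of them at the place given by its defect. -/
def lectureHallEncode : (q : ℕ) → (ℕ → ℕ) → Fin q → ℕ
  | 0, _ => Fin.elim0
  | q + 1, l => Fin.insertNth (α := fun _ => ℕ) ⟨ceilDefect l q, ceilDefect_lt l q⟩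
      (ceilRatio l q) (lectureHallEncode q l)

theorem lectureHallEncode_congr {q : ℕ} {l l' : ℕ → ℕ} (h : ∀ i < q, l i = l' i) :
    lectureHallEncode q l = lectureHallEncode q l' := by
  induction q with
  | zero => rfl
  | succ q ih =>
    have hq := h q (by omega)
    simp only [lectureHallEncode, ih fun i hi => h i (by omega), ceilDefect, ceilRatio, hq]

theorem IsLectureHall.of_succ {q : ℕ} {l : ℕ → ℕ} (h : IsLectureHall (q + 1) l) :
    IsLectureHall q l := fun i hi => h i (by omega)

/-- For entries `s = M * (q + 1) - k` and bounds `t * (q + 1) - j`. -/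
theorem add_le_mul_iff {q s M k t j : ℕ} (hk : k < q + 1) (hj : j ≤ q + 1)
    (h : s + k = M * (q + 1)) :
    s + j ≤ t * (q + 1) ↔ M + (if k < j then 1 else 0) ≤ t := by
  rcases lt_trichotomy M t with hM | rfl | hM
  · have : (M + 1) * (q + 1) ≤ t * (q + 1) := Nat.mul_le_mul_right _ hM
    rw [add_mul] at this
    split_ifs <;> omega
  · split_ifs <;> omega
  · have : (t + 1) * (q + 1) ≤ M * (q + 1) := Nat.mul_le_mul_right _ hM
    rw [add_mul] at this
    split_ifs <;> omega

theorem IsLectureHall.last_add_le_iff {q : ℕ} {l : ℕ → ℕ} (h : IsLectureHall (q + 1) l)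
    {t j : ℕ} (hj : j ≤ q + 1) :
    l q + j ≤ t * (q + 1) ↔
      ∀ i, lectureHallEncode (q + 1) l i + (if (i : ℕ) < j then 1 else 0) ≤ t := by
  induction q generalizing t j with
  | zero =>
    rw [add_le_mul_iff (ceilDefect_lt l 0) hj (add_ceilDefect l 0)]
    simp [lectureHallEncode, Fin.forall_fin_one, ceilDefect, ceilRatio]
  | succ q ih =>
    have hk := ceilDefect_lt l (q + 1)
    have hM := add_ceilDefect l (q + 1)
    rw [add_le_mul_iff hk hj hM, lectureHallEncode,
      Fin.forall_iff_succAbove ⟨ceilDefect l (q + 1), hk⟩]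
    simp only [Fin.insertNth_apply_same, Fin.insertNth_apply_succAbove]
    refine ⟨fun ht => ⟨ht, fun i => ?_⟩, fun ht => ht.1⟩
    have hle : l q + ceilDefect l (q + 1) ≤ ceilRatio l (q + 1) * (q + 1) := by
      have h1 := h q (by omega)
      generalize ceilRatio l (q + 1) = M at *
      generalize ceilDefect l (q + 1) = k at *
      have h2 : (l q + k) * (q + 2) < (M * (q + 1) + 1) * (q + 2) := by nlinarith
      exact Nat.lt_succ_iff.mp (Nat.lt_of_mul_lt_mul_right h2)
    have hi := (ih h.of_succ (by omega)).1 hle i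
    have hs : (((⟨ceilDefect l (q + 1), hk⟩ : Fin (q + 2)).succAbove i : Fin (q + 2)) : ℕ) =
        if (i : ℕ) < ceilDefect l (q + 1) then (i : ℕ) else i + 1 := by
      simp only [Fin.succAbove, Fin.lt_def, Fin.val_castSucc]
      split_ifs <;> rfl
    rw [hs]
    clear hs ih
    split_ifs at * <;> omega

theorem IsLectureHall.last_le_of_encode_eq {q : ℕ} {l l' : ℕ → ℕ}
    (h : IsLectureHall (q + 1) l) (h' : IsLectureHall (q + 1) l')
    (he : lectureHallEncode (q + 1) l = lectureHallEncode (q + 1) l') : l q ≤ l' q := by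
  have hk := ceilDefect_lt l' q
  have h1 := (h'.last_add_le_iff hk.le).1 (add_ceilDefect l' q).le
  rw [← he] at h1
  have h2 := (h.last_add_le_iff hk.le).2 h1
  have h3 := add_ceilDefect l' q
  omega

theorem IsLectureHall.eq_of_encode_eq {q : ℕ} {l l' : ℕ → ℕ}
    (h : IsLectureHall q l) (h' : IsLectureHall q l')
    (he : lectureHallEncode q l = lectureHallEncode q l') : ∀ i < q, l i = l' i := by
  induction q with
  | zero => simp
  | succ q ih =>
    have hq : l q = l' q :=
      (h.last_le_of_encode_eq h' he).antisymm (h'.last_le_of_encode_eq h he.symm)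
    simp only [lectureHallEncode, ceilDefect, ceilRatio, hq] at he
    have ih' := ih h.of_succ h'.of_succ (Fin.insertNth_inj.1 he).2
    intro i hi
    rcases Nat.lt_succ_iff_lt_or_eq.1 hi with hi | rfl
    · exact ih' i hi
    · exact hq

theorem exists_first_argmax {q : ℕ} (x : Fin (q + 1) → ℕ) :
    ∃ j, (∀ i, x i ≤ x j) ∧ ∀ i < j, x i < x j := by
  obtain ⟨j₀, hj₀⟩ := Finite.exists_max x
  obtain ⟨j, hj, hmin⟩ := wellFounded_lt.has_min {j | ∀ i, x i ≤ x j} ⟨j₀, hj₀⟩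
  refine ⟨j, hj, fun i hi => lt_of_le_of_ne (hj i) fun hij => hmin i ?_ hi⟩
  simpa only [Set.mem_ofPred_eq, hij] using hj

theorem exists_lectureHallEncode_eq {q : ℕ} (x : Fin q → ℕ) :
    ∃ l, IsLectureHall q l ∧ lectureHallEncode q l = x := by
  induction q with
  | zero => exact ⟨0, fun i hi => by omega, Subsingleton.elim _ _⟩
  | succ q ih =>
    obtain ⟨j, hmax, hfirst⟩ := exists_first_argmax x
    obtain ⟨l, hl, hlx⟩ := ih (j.removeNth x)
    have hjM : (j : ℕ) ≤ x j * (q + 1) := by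
      rcases Nat.eq_zero_or_pos (j : ℕ) with h0 | h0
      · omega
      · have := hfirst 0 (Fin.lt_def.2 (by simpa using h0))
        have : 1 * (q + 1) ≤ x j * (q + 1) := Nat.mul_le_mul_right _ (by omega)
        omega
    set l' := Function.update l q (x j * (q + 1) - j) with hl'
    have hlow : ∀ i < q, l' i = l i := fun i hi => Function.update_of_ne (by omega) _ _
    have hlast : l' q + j = x j * (q + 1) := by
      rw [hl', Function.update_self]; omega
    have hratio := ceilRatio_eq j.2 hlast
    have hdefect : ceilDefect l' q = j := by
      have := add_ceilDefect l' q
      rw [hratio] at this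
      omega
    refine ⟨l', fun i hi => ?_, ?_⟩
    · rcases Nat.lt_succ_iff_lt_or_eq.1 hi with hi' | rfl
      · rw [hlow _ hi', hlow i (by omega)]
        exact hl i hi'
      · rw [hlow i (by omega)]
        have hle : l i + j ≤ x j * (i + 1) := by
          rw [hl.last_add_le_iff (by omega), hlx]
          intro k
          simp only [Fin.removeNth_apply]
          split_ifs with hk
          · refine hfirst _ ?_
            have hk : k.castSucc < j := hk
            rwa [Fin.succAbove_of_castSucc_lt _ _ hk]
          · exact hmax _
        have hj := j.2
        generalize x j = M at *
        generalize (j : ℕ) = k at *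
        nlinarith
    · rw [lectureHallEncode, lectureHallEncode_congr hlow, hlx, hratio]
      have : (⟨ceilDefect l' q, ceilDefect_lt l' q⟩ : Fin (q + 1)) = j := Fin.ext hdefect
      rw [this]
      exact Fin.insertNth_self_removeNth j x

theorem exists_perm_lectureHallEncode (q : ℕ) (l : ℕ → ℕ) :
    ∃ σ : Equiv.Perm (Fin q), ∀ i, lectureHallEncode q l (σ i) = ceilRatio l i := by
  induction q with
  | zero => exact ⟨1, fun i => i.elim0⟩
  | succ q ih =>
    obtain ⟨σ, hσ⟩ := ih
    let j : Fin (q + 1) := ⟨ceilDefect l q, ceilDefect_lt l q⟩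
    let f : Fin (q + 1) → Fin (q + 1) :=
      Fin.snoc (α := fun _ => Fin (q + 1)) (fun i => j.succAbove (σ i)) j
    have hf : Function.Injective f := by
      refine Fin.snoc_injective_iff.2 ⟨Fin.succAbove_right_injective.comp σ.injective, ?_⟩
      rintro ⟨i, hi⟩
      exact Fin.succAbove_ne _ _ hi
    refine ⟨Equiv.ofBijective f (Finite.injective_iff_bijective.1 hf), fun i => ?_⟩
    refine Fin.lastCases ?_ (fun i => ?_) i
    · simp only [Equiv.ofBijective_apply, f, Fin.snoc_last, lectureHallEncode]
      exact Fin.insertNth_apply_same _ _ _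
    · simp only [Equiv.ofBijective_apply, f, Fin.snoc_castSucc, lectureHallEncode]
      exact (Fin.insertNth_apply_succAbove j _ _ _).trans (hσ i)

theorem IsLectureHall.monotone_ceilRatio {q : ℕ} {l : ℕ → ℕ} (h : IsLectureHall (q + 1) l) :
    Monotone fun i : Fin (q + 1) => ceilRatio l i := by
  refine Fin.monotone_iff_le_succ.2 fun i => ?_
  have h1 := h i (by omega)
  have h2 := add_ceilDefect l (i + 1)
  simp only [Fin.val_castSucc, Fin.val_succ]
  generalize ceilRatio l (i + 1) = M at *
  have h3 : l i * (i + 2) ≤ M * (i + 1) * (i + 2) := by nlinarith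
  have h4 := Nat.le_of_mul_le_mul_right h3 (by omega)
  unfold ceilRatio
  rw [← Nat.lt_succ_iff, Nat.div_lt_iff_lt_mul (by omega), Nat.succ_mul]
  omega

theorem natAbs_intEquivNat_symm (k : ℕ) : (Equiv.intEquivNat.symm k).natAbs = (k + 1) / 2 := by
  obtain ⟨z, rfl⟩ := Equiv.intEquivNat.surjective k
  rw [Equiv.symm_apply_apply]
  rcases z with z | z
  · change z = (2 * z + 1) / 2
    omega
  · change z + 1 = (2 * z + 1 + 1) / 2
    omega

/-- The sequence of natural numbers that continues a tuple of integers by zeros. -/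
def extendTuple {q : ℕ} (lam : Fin q → ℤ) (i : ℕ) : ℕ :=
  if h : i < q then (lam ⟨i, h⟩).toNat else 0

theorem extendTuple_apply {q : ℕ} (lam : Fin q → ℤ) (i : Fin q) :
    extendTuple lam i = (lam i).toNat := by
  simp [extendTuple]

theorem ceil_div_two_mul (l : ℕ → ℕ) (i : ℕ) :
    ⌈(l i : ℚ) / (2 * ((i : ℕ) + 1))⌉ = (((ceilRatio l i + 1) / 2 : ℕ) : ℤ) := by
  have hM := add_ceilDefect l i
  have hk := ceilDefect_lt l i
  generalize ceilRatio l i = M at *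
  generalize ceilDefect l i = k at *
  rw [Int.ceil_eq_iff, lt_div_iff₀ (by positivity), div_le_iff₀ (by positivity)]
  obtain ⟨z, hz⟩ : ∃ z, (M + 1) / 2 = z := ⟨_, rfl⟩
  rw [hz]
  have h1 : M ≤ 2 * z := by omega
  have h2 : 2 * z ≤ M + 1 := by omega
  have h3 : l i ≤ z * (2 * (i + 1)) := by nlinarith
  have h4 : z * (2 * (i + 1)) < l i + 2 * (i + 1) := by nlinarith
  have h3' : (l i : ℚ) ≤ z * (2 * (i + 1)) := by exact_mod_cast h3
  have h4' : (z * (2 * (i + 1)) : ℚ) < l i + 2 * (i + 1) := by exact_mod_cast h4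
  push_cast
  constructor <;> linarith

theorem lectureHall_iff {q : ℕ} (lam : Fin (q + 1) → ℤ) :
    (0 ≤ lam 0 ∧ ∀ (j : ℕ) (h : j + 1 < q + 1),
      (lam ⟨j, Nat.lt_of_succ_lt h⟩ : ℚ) / ((j : ℚ) + 1) ≤ (lam ⟨j + 1, h⟩ : ℚ) / ((j : ℚ) + 2)) ↔
    (∀ i, 0 ≤ lam i) ∧ IsLectureHall (q + 1) (extendTuple lam) := by
  have key (j : ℕ) (h : j + 1 < q + 1) :
      (lam ⟨j, Nat.lt_of_succ_lt h⟩ : ℚ) / ((j : ℚ) + 1) ≤ (lam ⟨j + 1, h⟩ : ℚ) / ((j : ℚ) + 2) ↔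
      lam ⟨j, Nat.lt_of_succ_lt h⟩ * (j + 2) ≤ lam ⟨j + 1, h⟩ * (j + 1) := by
    rw [div_le_div_iff₀ (by positivity) (by positivity)]
    exact_mod_cast Iff.rfl
  have key' (h0 : ∀ i, 0 ≤ lam i) (j : ℕ) (h : j + 1 < q + 1) :
      lam ⟨j, Nat.lt_of_succ_lt h⟩ * (j + 2) ≤ lam ⟨j + 1, h⟩ * (j + 1) ↔
      extendTuple lam j * (j + 2) ≤ extendTuple lam (j + 1) * (j + 1) := by
    simp only [extendTuple, h, Nat.lt_of_succ_lt h, dif_pos]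
    have h1 := Int.toNat_of_nonneg (h0 ⟨j, Nat.lt_of_succ_lt h⟩)
    have h2 := Int.toNat_of_nonneg (h0 ⟨j + 1, h⟩)
    zify
    rw [h1, h2]
  constructor
  · rintro ⟨h0, h⟩
    have hnn : ∀ i, 0 ≤ lam i := by
      refine Fin.induction h0 fun i hi => ?_
      have h1 := (key i (by omega)).1 (h i (by omega))
      have h2 : 0 ≤ lam i.castSucc * (i + 2) := by positivity
      exact nonneg_of_mul_nonneg_left (h2.trans h1) (by positivity)
    exact ⟨hnn, fun j hj => (key' hnn j hj).1 ((key j hj).1 (h j hj))⟩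
  · rintro ⟨hnn, h⟩
    exact ⟨hnn 0, fun j hj => (key j hj).2 ((key' hnn j hj).2 (h j hj))⟩

theorem sum_mul_abs_le_of_forall_sign {ι : Type*} [Fintype ι] {a x : ι → ℤ} {m : ℤ}
    (h : ∀ (π : Equiv.Perm ι) (ε : ι → ℤˣ), ∑ i, (ε i : ℤ) * a i * x (π i) ≤ m)
    (σ : Equiv.Perm ι) : ∑ i, a i * |x (σ i)| ≤ m := by
  refine (Finset.sum_congr rfl fun i _ => ?_).trans_le
    (h σ fun i => if 0 ≤ x (σ i) then 1 else -1)
  split_ifs with hx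
  · rw [abs_of_nonneg hx]; simp
  · rw [abs_of_neg (not_le.1 hx)]; simp

/-- A point lies in the type B symmetric polytope as soon as it satisfies the inequality for which
the absolute values of its coordinates are sorted. -/
theorem forall_signed_perm_sum_le_iff {ι : Type*} [Fintype ι] {a x : ι → ℤ} {m : ℤ}
    (h0 : ∀ i, 0 ≤ a i) {σ : Equiv.Perm ι} (hσ : Monovary a fun i => |x (σ i)|) :
    (∀ (π : Equiv.Perm ι) (ε : ι → ℤˣ), ∑ i, (ε i : ℤ) * a i * x (π i) ≤ m) ↔
      ∑ i, a i * |x (σ i)| ≤ m := by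
  constructor
  · exact fun h => sum_mul_abs_le_of_forall_sign h σ
  · intro h π ε
    refine le_trans (Finset.sum_le_sum fun i _ => ?_) ((hσ.sum_mul_comp_perm_le_sum_mul
      (σ := π.trans σ.symm)).trans h)
    simp only [Equiv.trans_apply, Equiv.apply_symm_apply]
    rcases Int.units_eq_one_or (ε i) with hε | hε
    · rw [hε, Units.val_one, one_mul]
      exact mul_le_mul_of_nonneg_left (le_abs_self _) (h0 i)
    · rw [hε, Units.val_neg, Units.val_one, neg_one_mul, neg_mul, ← mul_neg]
      exact mul_le_mul_of_nonneg_left (neg_le_abs _) (h0 i)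

theorem finite_forall_signed_perm_sum_le {ι : Type*} [Fintype ι] {a : ι → ℤ} (m : ℤ)
    (h0 : ∀ i, 0 ≤ a i) {k : ι} (hk : 0 < a k) :
    {x : ι → ℤ | ∀ (π : Equiv.Perm ι) (ε : ι → ℤˣ),
      ∑ i, (ε i : ℤ) * a i * x (π i) ≤ m}.Finite := by
  classical
  refine (Set.finite_Icc (fun _ : ι => -m) fun _ => m).subset fun x hx => ?_
  have hb (i : ι) : |x i| ≤ m := by
    have h2 := sum_mul_abs_le_of_forall_sign hx (Equiv.swap k i)
    have h3 := Finset.single_le_sum (f := fun j => a j * |x (Equiv.swap k i j)|)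
      (fun j _ => mul_nonneg (h0 j) (abs_nonneg _)) (Finset.mem_univ k)
    simp only [Equiv.swap_apply_left] at h3
    nlinarith [abs_nonneg (x i)]
  exact ⟨fun i => (abs_le.1 (hb i)).1, fun i => (abs_le.1 (hb i)).2⟩

/-- The map from lecture hall partitions to integer points. -/
def lectureHallToInt (q : ℕ) (lam : Fin q → ℤ) (i : Fin q) : ℤ :=
  Equiv.intEquivNat.symm (lectureHallEncode q (extendTuple lam) i)

theorem bijOn_lectureHallToInt (q : ℕ) :
    Set.BijOn (lectureHallToInt (q + 1))
      {lam | (∀ i, 0 ≤ lam i) ∧ IsLectureHall (q + 1) (extendTuple lam)} Set.univ := by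
  refine ⟨Set.mapsTo_univ _ _, ?_, fun x _ => ?_⟩
  · rintro lam ⟨h0, h⟩ lam' ⟨h0', h'⟩ he
    have he' : lectureHallEncode (q + 1) (extendTuple lam) =
        lectureHallEncode (q + 1) (extendTuple lam') :=
      funext fun i => Equiv.intEquivNat.symm.injective (congrFun he i)
    funext i
    have := h.eq_of_encode_eq h' he' i i.2
    rw [extendTuple_apply, extendTuple_apply] at this
    have h1 := h0 i
    have h2 := h0' i
    omega
  · obtain ⟨l, hl, hlx⟩ := exists_lectureHallEncode_eq fun i => Equiv.intEquivNat (x i)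
    have hext : ∀ i < q + 1, extendTuple (fun i : Fin (q + 1) => (l i : ℤ)) i = l i := by
      intro i hi
      simp [extendTuple, hi]
    refine ⟨fun i => l i, ⟨fun i => by positivity, fun i hi => ?_⟩, ?_⟩
    · rw [hext _ hi, hext i (by omega)]
      exact hl i hi
    · funext i
      rw [lectureHallToInt, lectureHallEncode_congr hext, hlx, Equiv.symm_apply_apply]

theorem forall_signed_perm_lectureHallToInt_iff {q : ℕ} {a lam : Fin (q + 1) → ℤ} {m : ℤ}
    (h0 : ∀ i, 0 ≤ a i) (ha : Monotone a) (hnn : ∀ i, 0 ≤ lam i)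
    (h : IsLectureHall (q + 1) (extendTuple lam)) :
    (∀ (π : Equiv.Perm (Fin (q + 1))) (ε : Fin (q + 1) → ℤˣ),
      ∑ i, (ε i : ℤ) * a i * lectureHallToInt (q + 1) lam (π i) ≤ m) ↔
    ∑ i : Fin (q + 1), a i * ⌈(lam i : ℚ) / (2 * ((i : ℕ) + 1))⌉ ≤ m := by
  obtain ⟨σ, hσ⟩ := exists_perm_lectureHallEncode (q + 1) (extendTuple lam)
  have habs (i : Fin (q + 1)) : |lectureHallToInt (q + 1) lam (σ i)| =
      (((ceilRatio (extendTuple lam) i + 1) / 2 : ℕ) : ℤ) := by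
    rw [lectureHallToInt, Int.abs_eq_natAbs, natAbs_intEquivNat_symm, hσ]
  have hmono : Monotone fun i => |lectureHallToInt (q + 1) lam (σ i)| := by
    intro i j hij
    simp only [habs]
    have := h.monotone_ceilRatio hij
    dsimp only at this
    exact_mod_cast Nat.div_le_div_right (Nat.succ_le_succ this)
  rw [forall_signed_perm_sum_le_iff h0 (ha.monovary hmono)]
  simp only [habs, ← ceil_div_two_mul, extendTuple_apply]
  have hcast (i : Fin (q + 1)) : (((lam i).toNat : ℕ) : ℚ) = lam i := by
    exact_mod_cast Int.toNat_of_nonneg (hnn i)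
  simp only [hcast]


/-- type B symmetrically constrained cones and lecture hall
partitions. Indices are 0-based: the 0-based index `i` corresponds to the
1-based index `i+1`, so `a i = 2d(i+1) + c` for `(i:ℕ) < n-2` and
`a ⟨n-2⟩ = 2d(n-1) + c + b`. `L` is the set of lecture hall partitions of
length `n-1`, `A m` the set of lecture hall partitions `λ` with
`Σ_i a_i ⌈λ_i/(2i)⌉ ≤ m` (1-based `i`), and `B' m` the set of integer points
of the `m`-th dilate of the type B symmetrically constrained polytope. Both
sets are finite and have the same cardinality, for every `m ≥ 0`. -/
theorem stmt_13 (n : ℕ) (hn : 3 ≤ n) (d c b : ℤ)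
    (hd : 0 ≤ d) (hc : -(2 * d) ≤ c) (hb : 0 ≤ b) (hnz : ¬(d = 0 ∧ c = 0 ∧ b = 0))
    (a : Fin (n - 1) → ℤ)
    (ha : ∀ i : Fin (n - 1), a i =
      if (i : ℕ) = n - 2 then 2 * d * (n - 1) + c + b else 2 * d * ((i : ℕ) + 1) + c)
    (L : Set (Fin (n - 1) → ℤ))
    (hL : L = {lam | 0 ≤ lam ⟨0, by omega⟩ ∧ ∀ (j : ℕ) (h : j + 1 < n - 1),
      (lam ⟨j, Nat.lt_of_succ_lt h⟩ : ℚ) / ((j : ℚ) + 1) ≤ (lam ⟨j + 1, h⟩ : ℚ) / ((j : ℚ) + 2)})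
    (m : ℕ)
    (A : Set (Fin (n - 1) → ℤ))
    (hA : A = {lam | lam ∈ L ∧
      ∑ i : Fin (n - 1), a i * ⌈(lam i : ℚ) / (2 * ((i : ℕ) + 1))⌉ ≤ (m : ℤ)})
    (B' : Set (Fin (n - 1) → ℤ))
    (hB' : B' = {x | ∀ (π : Equiv.Perm (Fin (n - 1))) (ε : Fin (n - 1) → ℤˣ),
      ∑ i, (ε i : ℤ) * a i * x (π i) ≤ (m : ℤ)}) :
    A.Finite ∧ B'.Finite ∧ Nat.card A = Nat.card B' := by
  obtain ⟨q, rfl⟩ : ∃ q, n = q + 2 := ⟨n - 2, by omega⟩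
  change Fin (q + 1) → ℤ at a
  have hlast (i : Fin (q + 1)) : (i : ℕ) ≤ q := Nat.lt_succ_iff.1 i.2
  have ha' (i : Fin (q + 1)) :
      a i = 2 * d * ((i : ℕ) + 1) + c + if (i : ℕ) = q then b else 0 := by
    rw [ha i]
    by_cases hi : (i : ℕ) = q
    · simp only [hi, Nat.add_sub_cancel, if_true]
      push_cast
      ring
    · simp [hi]
  have hmono : Monotone a := by
    intro i j hij
    have hij' : ((i : ℕ) : ℤ) ≤ (j : ℕ) := by exact_mod_cast hij
    have hd' := mul_le_mul_of_nonneg_left hij' hd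
    have hj := hlast j
    rw [ha', ha']
    split_ifs with h1 h2 h2
    · linarith
    · omega
    · linarith
    · linarith
  have h0 (i : Fin (q + 1)) : 0 ≤ a i := by
    rw [ha']
    have : 0 ≤ d * ((i : ℕ) : ℤ) := by positivity
    split_ifs <;> linarith
  have hpos : 0 < a (Fin.last q) := by
    rw [ha', Fin.val_last, if_pos rfl]
    have hq : (1 : ℤ) ≤ q := by omega
    have hdq := mul_le_mul_of_nonneg_left hq hd
    rcases hd.lt_or_eq with hd | rfl
    · linarith
    · have : c ≠ 0 ∨ b ≠ 0 := by tauto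
      omega
  have hbij : Set.BijOn (lectureHallToInt (q + 1)) A B' := by
    have hAeq : A = {lam | (∀ i, 0 ≤ lam i) ∧ IsLectureHall (q + 1) (extendTuple lam)} ∩
        lectureHallToInt (q + 1) ⁻¹' B' := by
      ext lam
      rw [hA, hL, hB']
      change (_ ∧ _) ∧ _ ↔ (_ ∧ _) ∧ _
      rw [← lectureHall_iff]
      refine and_congr_right fun hlam => ?_
      obtain ⟨hnn, h⟩ := (lectureHall_iff lam).1 hlam
      exact (forall_signed_perm_lectureHallToInt_iff h0 hmono hnn h).symm
    rw [hAeq]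
    have := bijOn_lectureHallToInt q
    refine ⟨fun x hx => hx.2, this.injOn.mono Set.inter_subset_left, fun x hx => ?_⟩
    obtain ⟨lam, hlam, rfl⟩ := this.surjOn (Set.mem_univ x)
    exact ⟨lam, ⟨hlam, hx⟩, rfl⟩
  have hfin : B'.Finite := by
    rw [hB']
    exact finite_forall_signed_perm_sum_le (ι := Fin (q + 1)) m h0 hpos
  exact ⟨hbij.finite_iff_finite.2 hfin, hfin, Nat.card_congr (hbij.equiv _)⟩
end

section
/- Let n ≥ 3 and let a_1, …, a_{n−1} and x_1, …, x_{n−1} be real numbers with |a_1| ≤ a_2 ≤ … ≤ a_{n−1} and |x_1| ≤ x_2 ≤ … ≤ x_{n−1}. Then for every permutation π of {1,…,n−1} and every sign vector ε ∈ E_{n−1}: ε_1a_1x_{π(1)} + ε_2a_2x_{π(2)} + … + ε_{n−1}a_{n−1}x_{π(n−1)} ≤ a_1x_1 + a_2x_2 + … + a_{n−1}x_{n−1}. -/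
/-- The rearrangement inequality with absolute values: signs of the summands do not matter. -/
theorem sum_abs_mul_abs_comp_perm_le {ι : Type*} [Fintype ι] [LinearOrder ι] {a x : ι → ℝ}
    (ha : Monotone fun i => |a i|) (hx : Monotone fun i => |x i|) (π : Equiv.Perm ι) :
    ∑ i, |a i| * |x (π i)| ≤ ∑ i, |a i| * |x i| :=
  (ha.monovary hx).sum_mul_comp_perm_le_sum_mul

/-- Rearrangement inequality for evenly signed permutations, on a linear order with least
element `b`, where only the entries at `b` may be negative. -/
theorem sum_sign_mul_comp_perm_le {ι : Type*} [Fintype ι] [LinearOrder ι] {a x : ι → ℝ}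
    {b : ι} (hb : ∀ i, b ≤ i)
    (ha : Monotone fun i => |a i|) (hx : Monotone fun i => |x i|)
    (ha0 : ∀ i, i ≠ b → 0 ≤ a i) (hx0 : ∀ i, i ≠ b → 0 ≤ x i)
    (π : Equiv.Perm ι) {ε : ι → ℝ} (hε : ∀ i, |ε i| = 1) (hprod : ∏ i, ε i = 1) :
    ∑ i, ε i * a i * x (π i) ≤ ∑ i, a i * x i := by
  have habs (i : ι) : |ε i * a i * x (π i)| = |a i| * |x (π i)| := by
    rw [abs_mul, abs_mul, hε, one_mul]
  have hle (i : ι) : ε i * a i * x (π i) ≤ |a i| * |x (π i)| := habs i ▸ le_abs_self _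
  have hperm := sum_abs_mul_abs_comp_perm_le ha hx π
  have hrest : ∑ i ∈ Finset.univ.erase b, |a i| * |x i| = ∑ i ∈ Finset.univ.erase b, a i * x i :=
    Finset.sum_congr rfl fun i hi => by
      have hi := Finset.ne_of_mem_erase hi
      rw [abs_of_nonneg (ha0 i hi), abs_of_nonneg (hx0 i hi)]
  rw [← Finset.add_sum_erase _ (fun i => |a i| * |x i|) (Finset.mem_univ b), hrest] at hperm
  rw [← Finset.add_sum_erase _ (fun i => a i * x i) (Finset.mem_univ b)]
  rcases le_total 0 (a b * x b) with h | h
  · rw [← abs_mul (a b), abs_of_nonneg h] at hperm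
    exact (Finset.sum_le_sum fun i _ => hle i).trans hperm
  · obtain ⟨j, hj⟩ : ∃ j, ε j * a j * x (π j) ≤ 0 := by
      by_contra! hpos
      have hP : 0 < ∏ i, ε i * a i * x (π i) := Finset.prod_pos fun i _ => hpos i
      rw [Finset.prod_mul_distrib, Finset.prod_mul_distrib, hprod, one_mul,
        Equiv.prod_comp π x, ← Finset.prod_mul_distrib,
        ← Finset.mul_prod_erase _ _ (Finset.mem_univ b)] at hP
      refine hP.not_ge (mul_nonpos_of_nonpos_of_nonneg h (Finset.prod_nonneg fun i hi => ?_))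
      have hi := Finset.ne_of_mem_erase hi
      exact mul_nonneg (ha0 i hi) (hx0 i hi)
    have hmin : |a b| * |x b| ≤ |a j| * |x (π j)| :=
      mul_le_mul (ha (hb j)) (hx (hb _)) (abs_nonneg _) (abs_nonneg _)
    have hsum : ∑ i ∈ Finset.univ.erase j, ε i * a i * x (π i)
        ≤ ∑ i ∈ Finset.univ.erase j, |a i| * |x (π i)| := Finset.sum_le_sum fun i _ => hle i
    have hneg := habs j
    rw [abs_of_nonpos hj] at hneg
    rw [← Finset.add_sum_erase _ _ (Finset.mem_univ j)] at hperm ⊢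
    rw [← abs_mul (a b), abs_of_nonpos h] at hperm hmin
    linarith

/-- A tuple in the fundamental domain of type `D` has only nonnegative entries past the first. -/
theorem nonneg_of_abs_zero_le {m : ℕ} {a : Fin (m + 2) → ℝ} (h : |a 0| ≤ a 1)
    (ha : ∀ j k : Fin (m + 2), 1 ≤ (j : ℕ) → j ≤ k → a j ≤ a k) (i : Fin (m + 2)) (hi : i ≠ 0) :
    0 ≤ a i :=
  (abs_nonneg _).trans (h.trans (ha 1 i le_rfl (Fin.one_le_of_ne_zero hi)))

/-- A tuple in the fundamental domain of type `D` has monotone absolute values. -/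
theorem monotone_abs_of_abs_zero_le {m : ℕ} {a : Fin (m + 2) → ℝ} (h : |a 0| ≤ a 1)
    (ha : ∀ j k : Fin (m + 2), 1 ≤ (j : ℕ) → j ≤ k → a j ≤ a k) : Monotone fun i => |a i| := by
  intro j k hjk
  rcases eq_or_ne k 0 with rfl | hk
  · rw [Fin.le_zero_iff.mp hjk]
  · refine le_trans ?_ (le_abs_self (a k))
    rcases eq_or_ne j 0 with rfl | hj
    · exact h.trans (ha 1 k le_rfl (Fin.one_le_of_ne_zero hk))
    · exact (abs_of_nonneg (nonneg_of_abs_zero_le h ha j hj)).trans_le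
        (ha j k (Fin.one_le_of_ne_zero hj) hjk)

/-- type D: the fundamental domain inequality dominates all
evenly-signed permuted versions. Indices are 0-based over `Fin (n-1)`:
the 0-based index `0` corresponds to the 1-based index `1`, so
`|a_1| ≤ a_2 ≤ ⋯ ≤ a_{n-1}` is encoded by `|a ⟨0⟩| ≤ a ⟨1⟩` together with
monotonicity on indices `≥ 1`, and similarly for `x`. The sign vector `ε`
has entries `±1` with product `1`. -/
theorem stmt_14 (n : ℕ) (hn : 3 ≤ n) (a x : Fin (n - 1) → ℝ)
    (ha1 : |a ⟨0, by omega⟩| ≤ a ⟨1, by omega⟩)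
    (ha : ∀ j k : Fin (n - 1), 1 ≤ (j : ℕ) → j ≤ k → a j ≤ a k)
    (hx1 : |x ⟨0, by omega⟩| ≤ x ⟨1, by omega⟩)
    (hx : ∀ j k : Fin (n - 1), 1 ≤ (j : ℕ) → j ≤ k → x j ≤ x k)
    (π : Equiv.Perm (Fin (n - 1))) (ε : Fin (n - 1) → ℝ)
    (hε : ∀ i, ε i = 1 ∨ ε i = -1) (hprod : ∏ i, ε i = 1) :
    ∑ i, ε i * a i * x (π i) ≤ ∑ i, a i * x i := by
  obtain ⟨m, rfl⟩ : ∃ m, n = m + 3 := ⟨n - 3, by omega⟩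
  exact sum_sign_mul_comp_perm_le (ι := Fin (m + 2)) (b := 0) Fin.zero_le
    (monotone_abs_of_abs_zero_le ha1 ha) (monotone_abs_of_abs_zero_le hx1 hx)
    (nonneg_of_abs_zero_le ha1 ha) (nonneg_of_abs_zero_le hx1 hx) π
    (fun i => by rcases hε i with h | h <;> simp [h]) hprod
end

section
/- Let n ≥ 3 and let a_1, …, a_{n−1} be integers with |a_1| ≤ a_2 ≤ … ≤ a_{n−1} and a_{n−1} ≥ 1. Set Σ_j := a_j + a_{j+1} + … + a_{n−1}, and let Γ := {x ∈ ℤ^n : x_1 ≡ x_2 ≡ … ≡ x_{n−1} (mod 2)}. Define vectors in ℤ^n: b_1 := e_1 + e_2 + … + e_{n−1} + Σ_1·e_n; b_2 := −e_1 + e_2 + … + e_{n−1} + (Σ_2 − a_1)·e_n; b_j := 2(e_j + e_{j+1} + … + e_{n−1}) + 2Σ_j·e_n for 3 ≤ j ≤ n−1; and b_n := e_n. Then b_1, …, b_n form a ℤ-basis of the lattice Γ, and {x ∈ Γ : |x_1| ≤ x_2 ≤ … ≤ x_{n−1} and a_1x_1 + … + a_{n−1}x_{n−1} ≤ x_n}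 = {λ_1 b_1 + … + λ_n b_n : λ_1, …, λ_n ∈ ℤ_{≥0}}. -/
/-- A family `b` mapped by an injective `Φ` to positive multiples of the standard basis spans freely
the lattice of vectors satisfying the corresponding divisibilities, and its nonnegative combinations
are the vectors of this lattice with nonnegative image. -/
theorem diagonal_family_lattice_and_cone {ι : Type*} [Fintype ι] [DecidableEq ι]
    (Φ : (ι → ℤ) →ₗ[ℤ] (ι → ℤ)) (hΦ : Function.Injective Φ) (c : ι → ℤ) (hc : ∀ k, 0 < c k)
    (b : ι → ι → ℤ) (hb : ∀ j, Φ (b j) = Pi.single j (c j)) :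
    (Function.Injective (fun lam : ι → ℤ => ∑ j, lam j • b j) ∧
      Set.range (fun lam : ι → ℤ => ∑ j, lam j • b j) = {x | ∀ k, c k ∣ Φ x k}) ∧
    {x | (∀ k, c k ∣ Φ x k) ∧ ∀ k, 0 ≤ Φ x k} =
      {x | ∃ lam : ι → ℕ, x = ∑ j, (lam j : ℤ) • b j} := by
  have key (lam : ι → ℤ) (k : ι) : Φ (∑ j, lam j • b j) k = c k * lam k := by
    simp only [map_sum, map_smul, hb, Finset.sum_apply, Pi.smul_apply, Pi.single_apply, smul_eq_mul]
    simp [mul_comm]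
  have expand (x : ι → ℤ) (lam : ι → ℤ) (h : ∀ k, Φ x k = c k * lam k) :
      x = ∑ j, lam j • b j :=
    hΦ (funext fun k => by rw [h, key])
  refine ⟨⟨fun l₁ l₂ h => funext fun k => ?_, Set.ext fun x => ⟨?_, fun h => ?_⟩⟩,
    Set.ext fun x => ⟨fun ⟨hdvd, hpos⟩ => ?_, ?_⟩⟩
  · have h' := congrArg (fun x => Φ x k) h
    simp only [key] at h'
    exact mul_left_cancel₀ (hc k).ne' h'
  · rintro ⟨lam, rfl⟩ k
    exact ⟨lam k, key lam k⟩
  · choose lam hlam using h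
    exact ⟨lam, (expand x lam hlam).symm⟩
  · choose lam hlam using hdvd
    have hnn (k : ι) : 0 ≤ lam k :=
      nonneg_of_mul_nonneg_right (hlam k ▸ hpos k) (hc k)
    refine ⟨fun k => (lam k).toNat, expand x _ fun k => ?_⟩
    rw [hlam, Int.toNat_of_nonneg (hnn k)]
  · rintro ⟨lam, rfl⟩
    refine ⟨fun k => ⟨lam k, key _ k⟩, fun k => ?_⟩
    rw [key]
    exact mul_nonneg (hc k).le (Int.natCast_nonneg _)

/-- The facet functionals of the type-D fundamental cone: `x₀ + x₁`, the consecutive differences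
`x_k - x_{k-1}`, and `x_{n-1} - ∑ aᵢ xᵢ`. -/
def facetMap (n : ℕ) (hn : 3 ≤ n) (a : Fin (n - 1) → ℤ) : (Fin n → ℤ) →ₗ[ℤ] (Fin n → ℤ) where
  toFun x k :=
    if (k : ℕ) = n - 1 then
      x ⟨n - 1, by omega⟩ - ∑ i : Fin (n - 1), a i * x (Fin.castLE (by omega) i)
    else if (k : ℕ) = 0 then x ⟨0, by omega⟩ + x ⟨1, by omega⟩
    else x k - x ⟨k - 1, by omega⟩
  map_add' x y := by
    ext k
    simp only [Pi.add_apply, mul_add, Finset.sum_add_distrib]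
    split_ifs <;> ring
  map_smul' r x := by
    ext k
    simp only [Pi.smul_apply, smul_eq_mul, RingHom.id_apply, mul_left_comm _ r, ← Finset.mul_sum]
    split_ifs <;> ring

section facetMap

variable {n : ℕ} (hn : 3 ≤ n) (a : Fin (n - 1) → ℤ) (x : Fin n → ℤ)

theorem facetMap_apply (k : Fin n) : facetMap n hn a x k =
    if (k : ℕ) = n - 1 then
      x ⟨n - 1, by omega⟩ - ∑ i : Fin (n - 1), a i * x (Fin.castLE (by omega) i)
    else if (k : ℕ) = 0 then x ⟨0, by omega⟩ + x ⟨1, by omega⟩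
    else x k - x ⟨k - 1, by omega⟩ := rfl

theorem facetMap_last : facetMap n hn a x ⟨n - 1, by omega⟩ =
    x ⟨n - 1, by omega⟩ - ∑ i : Fin (n - 1), a i * x (Fin.castLE (by omega) i) := by
  simp [facetMap_apply]

theorem facetMap_zero : facetMap n hn a x ⟨0, by omega⟩ = x ⟨0, by omega⟩ + x ⟨1, by omega⟩ := by
  rw [facetMap_apply, if_neg (by simp only; omega), if_pos rfl]

theorem facetMap_succ (k : ℕ) (hk : k + 1 < n - 1) :
    facetMap n hn a x ⟨k + 1, by omega⟩ = x ⟨k + 1, by omega⟩ - x ⟨k, by omega⟩ := by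
  rw [facetMap_apply, if_neg (by simp only; omega), if_neg (by simp)]
  rfl

theorem facetMap_injective : Function.Injective (facetMap n hn a) := by
  rw [injective_iff_map_eq_zero]
  intro x hx
  have h0 := facetMap_zero hn a x
  have h1 := facetMap_succ hn a x 0 (by omega)
  simp only [hx, Pi.zero_apply, zero_add] at h0 h1
  have hlt (k : ℕ) (hk : k < n - 1) : x ⟨k, by omega⟩ = 0 := by
    induction k with
    | zero => omega
    | succ k ih =>
      have hs := facetMap_succ hn a x k hk
      rw [hx, Pi.zero_apply, ih (by omega)] at hs
      omega
  have hl := facetMap_last hn a x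
  rw [hx, Pi.zero_apply, Finset.sum_eq_zero fun i _ => by
    rw [show x (Fin.castLE (by omega) i) = 0 from hlt i i.2, mul_zero]] at hl
  ext ⟨k, hk⟩
  obtain h | rfl : k < n - 1 ∨ k = n - 1 := by omega
  · exact hlt k h
  · simpa using hl.symm

theorem forall_dvd_facetMap_iff :
    (∀ k : Fin n, (if (k : ℕ) = n - 1 then 1 else 2 : ℤ) ∣ facetMap n hn a x k) ↔
      ∀ i j : Fin (n - 1),
        x (Fin.castLE (by omega) i) % 2 = x (Fin.castLE (by omega) j) % 2 := by
  constructor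
  · intro h
    have hlt (k : ℕ) (hk : k < n - 1) : x ⟨k, by omega⟩ % 2 = x ⟨0, by omega⟩ % 2 := by
      induction k with
      | zero => rfl
      | succ k ih =>
        have hs := h ⟨k + 1, by omega⟩
        rw [if_neg (by simp only; omega), facetMap_succ hn a x k hk] at hs
        have := ih (by omega)
        omega
    exact fun i j => (hlt i i.2).trans (hlt j j.2).symm
  · rintro h ⟨k, hk⟩
    split_ifs with hkn
    · exact one_dvd _
    · simp only at hkn
      cases k with
      | zero =>
        have h' : x ⟨0, by omega⟩ % 2 = x ⟨1, by omega⟩ % 2 := h ⟨0, by omega⟩ ⟨1, by omega⟩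
        rw [facetMap_zero]
        omega
      | succ k =>
        have h' : x ⟨k, by omega⟩ % 2 = x ⟨k + 1, by omega⟩ % 2 :=
          h ⟨k, by omega⟩ ⟨k + 1, by omega⟩
        rw [facetMap_succ hn a x k (by omega)]
        omega

theorem forall_facetMap_nonneg_iff :
    (∀ k, 0 ≤ facetMap n hn a x k) ↔
      |x ⟨0, by omega⟩| ≤ x ⟨1, by omega⟩ ∧
        (∀ j k : Fin (n - 1), 1 ≤ (j : ℕ) → j ≤ k →
          x (Fin.castLE (by omega) j) ≤ x (Fin.castLE (by omega) k)) ∧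
        ∑ i : Fin (n - 1), a i * x (Fin.castLE (by omega) i) ≤ x ⟨n - 1, by omega⟩ := by
  constructor
  · intro h
    refine ⟨?_, ?_, ?_⟩
    · have h0 := facetMap_zero hn a x ▸ h ⟨0, by omega⟩
      have h1 := facetMap_succ hn a x 0 (by omega) ▸ h ⟨1, by omega⟩
      simp only [zero_add] at h1
      rw [abs_le]
      constructor <;> linarith
    · rintro ⟨j, hj⟩ ⟨k, hk⟩ - hjk
      replace hjk : j ≤ k := hjk
      change x ⟨j, by omega⟩ ≤ x ⟨k, by omega⟩
      induction k, hjk using Nat.le_induction with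
      | base => rfl
      | succ k _ ih =>
        have hs := facetMap_succ hn a x k hk ▸ h ⟨k + 1, by omega⟩
        linarith [ih (by omega)]
    · have hl := facetMap_last hn a x ▸ h ⟨n - 1, by omega⟩
      linarith
  · rintro ⟨habs, hmono, hl⟩ ⟨k, hk⟩
    rw [abs_le] at habs
    obtain rfl | hkn := eq_or_ne k (n - 1)
    · rw [facetMap_last]
      linarith
    · match k with
      | 0 =>
        rw [facetMap_zero]
        linarith
      | 1 =>
        rw [facetMap_succ hn a x 0 (by omega)]
        simp only [zero_add]
        linarith
      | k + 2 =>
        rw [facetMap_succ hn a x (k + 1) (by omega)]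
        exact sub_nonneg.2 (hmono ⟨k + 1, by omega⟩ ⟨k + 2, by omega⟩ (by simp)
          (by simp [Fin.le_def]))

end facetMap


/-- type D: the fundamental cone is simplicial and
unimodular with respect to the sublattice `Γ`. Indices are 0-based: the
0-based index `j` corresponds to the 1-based index `j+1`, so
`S j = a_{j+1} + ⋯ + a_{n-1}` (1-based `Σ_{j+1}`). In 0-based coordinates:
`b 0 = e_0 + ⋯ + e_{n-2} + Σ_1 e_{n-1}`,
`b 1 = -e_0 + e_1 + ⋯ + e_{n-2} + (Σ_2 - a_1) e_{n-1}`,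
`b j = 2(e_j + ⋯ + e_{n-2}) + 2 Σ_{j+1} e_{n-1}` for `2 ≤ (j:ℕ) ≤ n-3`, and
`b ⟨n-1⟩ = e_{n-1}`. `Γ` is the sublattice of `ℤⁿ` whose first `n-1`
coordinates are congruent mod 2. The `b j` form a ℤ-basis of `Γ` and the
fundamental cone `C₊ ∩ Γ` consists exactly of the ℤ_{≥0}-combinations of
the `b j`. -/
theorem stmt_15 (n : ℕ) (hn : 3 ≤ n) (a : Fin (n - 1) → ℤ)
    (ha1 : |a ⟨0, by omega⟩| ≤ a ⟨1, by omega⟩)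
    (ha : ∀ j k : Fin (n - 1), 1 ≤ (j : ℕ) → j ≤ k → a j ≤ a k)
    (halast : 1 ≤ a ⟨n - 2, by omega⟩)
    (S : ℕ → ℤ)
    (hS : ∀ j, S j = ∑ i ∈ Finset.univ.filter (fun i : Fin (n - 1) => j ≤ (i : ℕ)), a i)
    (Γ : Set (Fin n → ℤ))
    (hΓ : Γ = {x | ∀ i j : Fin (n - 1),
      x (Fin.castLE (by omega) i) % 2 = x (Fin.castLE (by omega) j) % 2})
    (b : Fin n → Fin n → ℤ)
    (hb : ∀ j i, b j i =
      if (j : ℕ) = n - 1 then (if (i : ℕ) = n - 1 then 1 else 0)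
      else if (i : ℕ) = n - 1 then
        (if (j : ℕ) = 0 then S 0
         else if (j : ℕ) = 1 then S 1 - a ⟨0, by omega⟩
         else 2 * S (j : ℕ))
      else
        (if (j : ℕ) = 0 then 1
         else if (j : ℕ) = 1 then (if (i : ℕ) = 0 then -1 else 1)
         else (if (j : ℕ) ≤ (i : ℕ) then 2 else 0))) :
    (Function.Injective (fun lam : Fin n → ℤ => ∑ j, lam j • b j) ∧
      Set.range (fun lam : Fin n → ℤ => ∑ j, lam j • b j) = Γ) ∧
    {x : Fin n → ℤ | x ∈ Γ ∧
        |x ⟨0, by omega⟩| ≤ x ⟨1, by omega⟩ ∧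
        (∀ j k : Fin (n - 1), 1 ≤ (j : ℕ) → j ≤ k →
          x (Fin.castLE (by omega) j) ≤ x (Fin.castLE (by omega) k)) ∧
        ∑ i : Fin (n - 1), a i * x (Fin.castLE (by omega) i) ≤ x ⟨n - 1, by omega⟩} =
      {x : Fin n → ℤ | ∃ lam : Fin n → ℕ, x = ∑ j, (lam j : ℤ) • b j} := by
  have hsum (j : Fin n) (hj : (j : ℕ) ≠ n - 1) :
      ∑ i : Fin (n - 1), a i * b j (Fin.castLE (by omega) i) = b j ⟨n - 1, by omega⟩ := by
    have hi (i : Fin (n - 1)) : (i : ℕ) ≠ n - 1 := i.2.ne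
    simp only [hb, hj, hi, if_true, if_false, Fin.val_castLE, hS, Finset.sum_filter]
    split_ifs with h0 h1
    · simp
    · have h := Finset.sum_ite_eq' Finset.univ (⟨0, by omega⟩ : Fin (n - 1)) a
      rw [if_pos (Finset.mem_univ _)] at h
      rw [← h, ← Finset.sum_sub_distrib]
      refine Finset.sum_congr rfl fun i _ => ?_
      simp only [Fin.ext_iff]
      split_ifs <;> omega
    · rw [Finset.mul_sum]
      refine Finset.sum_congr rfl fun i _ => ?_
      split_ifs <;> ring
  have hfacet (j : Fin n) : facetMap n hn a (b j) =
      Pi.single j (if (j : ℕ) = n - 1 then 1 else 2) := by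
    ext ⟨k, hk⟩
    rw [Pi.single_apply]
    obtain rfl | hkn := eq_or_ne k (n - 1)
    · rw [facetMap_last]
      by_cases hj : (j : ℕ) = n - 1
      · have hi (i : Fin (n - 1)) : (i : ℕ) ≠ n - 1 := i.2.ne
        simp [hb, hj, hi, Fin.ext_iff]
      · rw [hsum j hj, sub_self, if_neg (by rw [Fin.ext_iff]; exact Ne.symm hj)]
    · cases k with
      | zero =>
        rw [facetMap_zero, hb, hb]
        simp only [Fin.ext_iff]
        split_ifs <;> first | contradiction | omega
      | succ k =>
        rw [facetMap_succ hn a _ k (by omega), hb, hb]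
        simp only [Fin.ext_iff]
        split_ifs <;> first | contradiction | omega
  have main := diagonal_family_lattice_and_cone (facetMap n hn a) (facetMap_injective hn a)
    (fun k => if (k : ℕ) = n - 1 then 1 else 2) (fun k => by split_ifs <;> norm_num) b hfacet
  simp only [forall_dvd_facetMap_iff, forall_facetMap_nonneg_iff] at main
  rw [hΓ]
  exact main
end

section
/- Let n ≥ 3. For every x ∈ ℝ^{n−1} there is a unique pair (π, ε) ∈ S_{n−1} × E_{n−1} such that, setting y_i := ε_i x_{π(i)} for 1 ≤ i ≤ n−1, one has |y_1| ≤ y_2 ≤ … ≤ y_{n−1}, with strict inequality at every descent position: y_1 > −y_2 whenever 1 ∈ D(π,ε), and y_{j−1} < y_j whenever j ∈ D(π,ε) with j ≥ 2. -/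
lemma strictMono_abs_and_pos_iff {G : Type*} [AddCommGroup G] [LinearOrder G]
    [IsOrderedAddMonoid G] {m : ℕ} (z : Fin (m + 2) → G) :
    (StrictMono (fun j => |z j|) ∧ ∀ j : Fin (m + 1), 0 < z j.succ) ↔
      |z 0| < z 1 ∧ ∀ j : Fin m, z j.succ.castSucc < z j.succ.succ := by
  rw [Fin.strictMono_iff_lt_succ]
  constructor
  · rintro ⟨hmono, hpos⟩
    refine ⟨?_, fun j => ?_⟩
    · have h := hmono 0
      rwa [Fin.castSucc_zero, Fin.succ_zero_eq_one, abs_of_pos (a := z 1) (hpos 0)] at h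
    · have h := hmono j.succ
      rwa [abs_of_pos (hpos j.succ), ← Fin.succ_castSucc, abs_of_pos (hpos j.castSucc)] at h
  · rintro ⟨h0, h⟩
    have hpos : ∀ j : Fin (m + 1), 0 < z j.succ := by
      intro j
      induction j using Fin.induction with
      | zero => exact (abs_nonneg _).trans_lt h0
      | succ j ih => exact ih.trans (by simpa using h j)
    refine ⟨fun j => ?_, hpos⟩
    rw [abs_of_pos (hpos j)]
    cases j using Fin.cases with
    | zero => exact h0
    | succ j =>
      rw [← Fin.succ_castSucc, abs_of_pos (hpos j.castSucc)]
      exact h j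

lemma abs_units_smul {G : Type*} [AddCommGroup G] [LinearOrder G] [IsOrderedAddMonoid G]
    (u : ℤˣ) (a : G) : |u • a| = |a| := by
  rcases Int.units_eq_one_or u with rfl | rfl <;> simp [Units.smul_def]

lemma existsUnique_perm_sign {G : Type*} [AddCommGroup G] [LinearOrder G]
    [IsOrderedAddMonoid G] {m : ℕ} (k : Fin (m + 2) → G)
    (hk : Function.Injective fun i => |k i|) :
    ∃! p : Equiv.Perm (Fin (m + 2)) × (Fin (m + 2) → ℤˣ),
      ∏ i, p.2 i = 1 ∧ StrictMono (fun j => |p.2 j • k (p.1 j)|) ∧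
        ∀ j : Fin (m + 1), 0 < p.2 j.succ • k (p.1 j.succ) := by
  simp only [abs_units_smul]
  set π := Tuple.sort fun i => |k i|
  have hmono : StrictMono fun j => |k (π j)| :=
    (Tuple.monotone_sort fun i => |k i|).strictMono_of_injective (hk.comp π.injective)
  have hne : ∀ j : Fin (m + 1), k (π j.succ) ≠ 0 := fun j =>
    abs_pos.mp ((abs_nonneg _).trans_lt (hmono (Fin.succ_pos j)))
  have hsign : ∀ a : G, a ≠ 0 → ∃ u : ℤˣ, 0 < u • a := by
    intro a ha
    rcases ha.lt_or_gt with h | h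
    · exact ⟨-1, by simpa [Units.smul_def] using h⟩
    · exact ⟨1, by simpa [Units.smul_def] using h⟩
  choose s hs using fun j => hsign _ (hne j)
  refine ⟨(π, Fin.cons (∏ j, s j) s), ⟨?_, hmono, fun j => ?_⟩, ?_⟩
  · rw [Fin.prod_univ_succ]
    simp [Int.units_mul_self]
  · simpa using hs j
  · rintro ⟨τ, ε⟩ ⟨hprod, hτ, hε⟩
    have hτπ : τ = π := by
      ext1 j
      exact hk (congrFun (Tuple.unique_monotone (f := fun i => |k i|) hτ.monotone hmono.monotone) j)
    subst hτπ
    have hεs : ∀ j : Fin (m + 1), ε j.succ = s j := by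
      intro j
      have h₁ := hε j
      have h₂ := hs j
      rcases Int.units_eq_one_or (ε j.succ) with e₁ | e₁ <;>
        rcases Int.units_eq_one_or (s j) with e₂ | e₂ <;>
        simp only [e₁, e₂, Units.smul_def, Units.val_neg, Units.val_one, one_smul, neg_smul,
          Left.neg_pos_iff] at h₁ h₂ ⊢
      exacts [(lt_asymm h₁ h₂).elim, (lt_asymm h₁ h₂).elim]
    refine Prod.ext rfl (funext fun j => ?_)
    cases j using Fin.cases with
    | zero =>
      rw [Fin.prod_univ_succ] at hprod
      simp only [hεs] at hprod
      simpa [Int.units_inv_eq_self] using eq_inv_of_mul_eq_one_left hprod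
    | succ j => simpa using hεs j

lemma toLex_lt_toLex_iff_of_ne {α β : Type*} [LinearOrder α] [LinearOrder β] {a a' : α}
    {b b' : β} (h : b ≠ b') :
    toLex (a, b) < toLex (a', b') ↔ a ≤ a' ∧ (b' < b → a < a') := by
  rw [Prod.Lex.toLex_lt_toLex]
  grind

/-- type D disjoint decomposition. Positions are 0-based:
the 0-based position `j` corresponds to the 1-based position `j+1`, and
`val π ε j = ε_{j+1}·π(j+1)` encodes the signed one-line notation (1-based
value `(π j : ℕ) + 1`). With the type-D convention `ε_0 π(0) := -ε_2 π(2)`,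
the 1-based position `1` (0-based `0`) is a descent iff `val π ε 0 < -val π ε 1`,
and a 1-based position `j+2 ≥ 2` (0-based `j+1 ≥ 1`) is a descent iff
`val π ε (j+1) < val π ε j`. Writing `y_j = ε_j x_{π(j)}`, for every
`x ∈ ℝ^{n-1}` there is a unique pair `(π, ε)` with `ε` of sign product `1`
such that `|y_1| ≤ y_2 ≤ ⋯ ≤ y_{n-1}`, with strict inequality at every
descent position. -/
theorem stmt_16 (n : ℕ) (hn : 3 ≤ n) (x : Fin (n - 1) → ℝ)
    (val : Equiv.Perm (Fin (n - 1)) → (Fin (n - 1) → ℤˣ) → Fin (n - 1) → ℤ)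
    (hval : ∀ π ε j, val π ε j = (ε j : ℤ) * ((π j : ℕ) + 1)) :
    ∃! p : Equiv.Perm (Fin (n - 1)) × (Fin (n - 1) → ℤˣ),
      (∏ i, p.2 i = 1) ∧
      (|((p.2 ⟨0, by omega⟩ : ℤ) : ℝ) * x (p.1 ⟨0, by omega⟩)| ≤
        ((p.2 ⟨1, by omega⟩ : ℤ) : ℝ) * x (p.1 ⟨1, by omega⟩)) ∧
      (∀ (j : ℕ), 1 ≤ j → ∀ (h : j + 1 < n - 1),
        ((p.2 ⟨j, Nat.lt_of_succ_lt h⟩ : ℤ) : ℝ) * x (p.1 ⟨j, Nat.lt_of_succ_lt h⟩) ≤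
          ((p.2 ⟨j + 1, h⟩ : ℤ) : ℝ) * x (p.1 ⟨j + 1, h⟩)) ∧
      (val p.1 p.2 ⟨0, by omega⟩ < -val p.1 p.2 ⟨1, by omega⟩ →
        -(((p.2 ⟨1, by omega⟩ : ℤ) : ℝ) * x (p.1 ⟨1, by omega⟩)) <
          ((p.2 ⟨0, by omega⟩ : ℤ) : ℝ) * x (p.1 ⟨0, by omega⟩)) ∧
      (∀ (j : ℕ) (h : j + 1 < n - 1),
        val p.1 p.2 ⟨j + 1, h⟩ < val p.1 p.2 ⟨j, Nat.lt_of_succ_lt h⟩ →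
          ((p.2 ⟨j, Nat.lt_of_succ_lt h⟩ : ℤ) : ℝ) * x (p.1 ⟨j, Nat.lt_of_succ_lt h⟩) <
            ((p.2 ⟨j + 1, h⟩ : ℤ) : ℝ) * x (p.1 ⟨j + 1, h⟩)) := by
  obtain ⟨m, rfl⟩ : ∃ m, n = m + 3 := ⟨n - 3, by omega⟩
  change Fin (m + 2) → ℝ at x
  let k : Fin (m + 2) → ℝ ×ₗ ℤ := fun i => toLex (x i, ((i : ℕ) : ℤ) + 1)
  have hk : Function.Injective fun i => |k i| := by
    intro i j hij
    rcases abs_eq_abs.mp hij with h | h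
    · have h' : ((i : ℕ) : ℤ) + 1 = ((j : ℕ) : ℤ) + 1 := congrArg (fun q => (ofLex q).2) h
      exact Fin.ext (by omega)
    · have h' : ((i : ℕ) : ℤ) + 1 = -(((j : ℕ) : ℤ) + 1) := congrArg (fun q => (ofLex q).2) h
      omega
  refine (existsUnique_congr fun p => and_congr_right fun _ => ?_).mp (existsUnique_perm_sign k hk)
  obtain ⟨π, ε⟩ := p
  change Equiv.Perm (Fin (m + 2)) at π
  change Fin (m + 2) → ℤˣ at ε
  have hz : ∀ j, ε j • k (π j) = toLex (((ε j : ℤ) : ℝ) * x (π j), val π ε j) := by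
    intro j
    rw [hval, ← zsmul_eq_mul, ← smul_eq_mul (ε j : ℤ)]
    rfl
  have hne : ∀ i j : Fin (m + 2), i ≠ j → val π ε i ≠ val π ε j ∧ val π ε i ≠ -val π ε j := by
    intro i j hij
    have hπ : ((π i : ℕ) : ℤ) ≠ (π j : ℕ) := fun h =>
      hij (π.injective (Fin.ext (by exact_mod_cast h)))
    rw [hval, hval]
    rcases Int.units_eq_one_or (ε i) with e₁ | e₁ <;>
      rcases Int.units_eq_one_or (ε j) with e₂ | e₂ <;>
      simp only [e₁, e₂, Units.val_neg, Units.val_one] <;> omega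
  rw [strictMono_abs_and_pos_iff (fun j => ε j • k (π j)), abs_lt]
  simp only [hz]
  have hneg : ∀ (a : ℝ) (b : ℤ), -toLex (a, b) = toLex (-a, -b) := fun _ _ => rfl
  rw [hneg, toLex_lt_toLex_iff_of_ne (hne 0 1 (by simp)).2.symm,
    toLex_lt_toLex_iff_of_ne (hne 0 1 (by simp)).1, abs_le]
  constructor
  · rintro ⟨⟨⟨hl, hl'⟩, hr, hr'⟩, h⟩
    have hsucc : ∀ (j : ℕ) (hj : j + 1 < m + 1), _ := fun j hj =>
      (toLex_lt_toLex_iff_of_ne (hne ⟨j + 1, by omega⟩ ⟨j + 2, by omega⟩ (by simp)).1).mp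
        (h ⟨j, by omega⟩)
    refine ⟨⟨hl, hr⟩, ?_, hl', ?_⟩
    · rintro (_ | j) hj hj'
      · omega
      · exact (hsucc j (by omega)).1
    · rintro (_ | j) hj
      · exact hr'
      · exact (hsucc j (by omega)).2
  · rintro ⟨⟨hl, hr⟩, hle, hl', hlt⟩
    refine ⟨⟨⟨hl, hl'⟩, hr, hlt 0 (by omega)⟩, fun j => ?_⟩
    have hj : (j : ℕ) + 1 + 1 < m + 3 - 1 := by omega
    exact (toLex_lt_toLex_iff_of_ne
      (hne j.succ.castSucc j.succ.succ (by simp [Fin.ext_iff])).1).mpr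
        ⟨hle (j + 1) (by omega) hj, hlt (j + 1) hj⟩
end

section
/- Let n ≥ 3 and let a_1, …, a_{n−1} be integers with |a_1| ≤ a_2 ≤ … ≤ a_{n−1} and a_{n−1} ≥ 1. Set Σ_j := a_j + … + a_{n−1} and Γ := {x ∈ ℤ^n : x_1 ≡ x_2 ≡ … ≡ x_{n−1} (mod 2)}. Define b_1 := e_1 + e_2 + … + e_{n−1} + Σ_1·e_n; b_2 := −e_1 + e_2 + … + e_{n−1} + (Σ_2 − a_1)·e_n; b_j := 2(e_j + … + e_{n−1}) + 2Σ_j·e_n for 3 ≤ j ≤ n−1; and b_n := e_n. Let C := {x ∈ ℝ^n : ∀π ∈ S_{n−1}, ∀ε ∈ E_{n−1}, ε_1a_1x_{π(1)} + … + ε_{n−1}a_{n−1}x_{π(n−1)} ≤ x_n}. Then the map from (S_{n−1} × E_{n−1}) × ℤ_{≥0}^n to C ∩ Γ sending ((π,ε), λ) to the vector x defined by x_{π(i)} := ε_i·y_i for 1 ≤ i ≤ n−1 and x_n := y_n, where y := Σ_{j=1}^n (λ_j + [j ∈ D(π,ε)])·b_j (and [P] is 1 if P holds and 0 otherwise), is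 a bijection. -/
/-- The type-`D` rearrangement inequality: for dominant vectors `a` and `y`, an even signed
permutation of `y` cannot increase the pairing with `a`. -/
theorem sum_signed_perm_le_s17 {m : ℕ} (hm : 0 < m) (a y : Fin m → ℤ)
    (ha : Monotone fun i => |a i|) (ha' : ∀ i : Fin m, 0 < (i : ℕ) → 0 ≤ a i)
    (hy : Monotone fun i => |y i|) (hy' : ∀ i : Fin m, 0 < (i : ℕ) → 0 ≤ y i)
    (π : Equiv.Perm (Fin m)) (ε : Fin m → ℤˣ) (hε : ∏ i, ε i = 1) :
    ∑ i, (ε i : ℤ) * a i * y (π i) ≤ ∑ i, a i * y i := by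
  have habs : ∀ i, |(ε i : ℤ) * a i * y (π i)| = |a i| * |y (π i)| := by
    intro i
    rw [abs_mul, abs_mul, Int.isUnit_iff_abs_eq.mp (ε i).isUnit, one_mul]
  have hrearr : ∑ i, |a i| * |y (π i)| ≤ ∑ i, |a i| * |y i| :=
    (ha.monovary hy).sum_mul_comp_perm_le_sum_mul
  have hpos : ∀ i : Fin m, 0 < (i : ℕ) → |a i| * |y i| = a i * y i := fun i hi => by
    rw [abs_of_nonneg (ha' i hi), abs_of_nonneg (hy' i hi)]
  rcases le_or_gt 0 (a ⟨0, hm⟩ * y ⟨0, hm⟩) with h0 | h0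
  · calc ∑ i, (ε i : ℤ) * a i * y (π i) ≤ ∑ i, |a i| * |y (π i)| :=
          Finset.sum_le_sum fun i _ => (le_abs_self _).trans (habs i).le
      _ ≤ ∑ i, |a i| * |y i| := hrearr
      _ = ∑ i, a i * y i := by
          refine Finset.sum_congr rfl fun i _ => ?_
          rcases Nat.eq_zero_or_pos (i : ℕ) with hi | hi
          · obtain rfl : i = ⟨0, hm⟩ := Fin.ext hi
            rw [← abs_mul, abs_of_nonneg h0]
          · exact hpos i hi
  · have hprod : ∏ i, ((ε i : ℤ) * a i * y (π i)) = ∏ i, (a i * y i) := by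
      have h1 : ∏ i, (ε i : ℤ) = 1 := by
        rw [← Units.coe_prod, hε, Units.val_one]
      rw [Finset.prod_mul_distrib, Finset.prod_mul_distrib, h1, one_mul,
        Equiv.prod_comp π y, Finset.prod_mul_distrib]
    have ha0 : 0 < |a ⟨0, hm⟩| := abs_pos.mpr fun h => by simp [h] at h0
    have hy0 : 0 < |y ⟨0, hm⟩| := abs_pos.mpr fun h => by simp [h] at h0
    have hneg : ∏ i, (a i * y i) < 0 := by
      rw [← Finset.mul_prod_erase _ _ (Finset.mem_univ (⟨0, hm⟩ : Fin m))]
      refine mul_neg_of_neg_of_pos h0 (Finset.prod_pos fun i hi => ?_)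
      have hi0 : 0 < (i : ℕ) := Nat.pos_of_ne_zero fun h =>
        (Finset.mem_erase.mp hi).1 (Fin.ext h)
      rw [← hpos i hi0]
      exact mul_pos (ha0.trans_le (ha (Fin.mk_le_of_le_val (Nat.zero_le _))))
        (hy0.trans_le (hy (Fin.mk_le_of_le_val (Nat.zero_le _))))
    obtain ⟨k, hk⟩ : ∃ k, (ε k : ℤ) * a k * y (π k) < 0 := by
      by_contra! h
      exact absurd (Finset.prod_nonneg fun i _ => h i) (by rw [hprod]; exact hneg.not_ge)
    have hk' : |a ⟨0, hm⟩| * |y ⟨0, hm⟩| ≤ |a k| * |y (π k)| :=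
      mul_le_mul (ha (Fin.mk_le_of_le_val (Nat.zero_le _)))
        (hy (Fin.mk_le_of_le_val (Nat.zero_le _))) (abs_nonneg _) (abs_nonneg _)
    have hl : ∑ i, (ε i : ℤ) * a i * y (π i) + 2 * (|a k| * |y (π k)|)
        ≤ ∑ i, |a i| * |y (π i)| := by
      rw [← Finset.add_sum_erase _ _ (Finset.mem_univ k),
        ← Finset.add_sum_erase _ (fun i => |a i| * |y (π i)|) (Finset.mem_univ k)]
      have h1 := habs k
      rw [abs_of_neg hk] at h1
      have h2 : ∑ i ∈ Finset.univ.erase k, (ε i : ℤ) * a i * y (π i)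
          ≤ ∑ i ∈ Finset.univ.erase k, |a i| * |y (π i)| :=
        Finset.sum_le_sum fun i _ => (le_abs_self _).trans (habs i).le
      linarith
    have hr : ∑ i, |a i| * |y i| = ∑ i, a i * y i + 2 * (|a ⟨0, hm⟩| * |y ⟨0, hm⟩|) := by
      rw [← Finset.add_sum_erase _ (fun i => |a i| * |y i|) (Finset.mem_univ (⟨0, hm⟩ : Fin m)),
        ← Finset.add_sum_erase _ (fun i => a i * y i) (Finset.mem_univ (⟨0, hm⟩ : Fin m))]
      have h2 : ∑ i ∈ Finset.univ.erase (⟨0, hm⟩ : Fin m), |a i| * |y i|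
          = ∑ i ∈ Finset.univ.erase (⟨0, hm⟩ : Fin m), a i * y i :=
        Finset.sum_congr rfl fun i hi => hpos i <| Nat.pos_of_ne_zero fun h =>
          (Finset.mem_erase.mp hi).1 (Fin.ext h)
      have h3 : |a ⟨0, hm⟩| * |y ⟨0, hm⟩| = -(a ⟨0, hm⟩ * y ⟨0, hm⟩) := by
        rw [← abs_mul, abs_of_neg h0]
      rw [h2, h3]; ring
    linarith

/-- A `D`-regular vector can be moved to the open dominant chamber. -/
theorem exists_signed_perm_dominant {m : ℕ} (hm : 0 < m) (X : Fin m → ℤ)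
    (hX : Function.Injective fun i => |X i|) :
    ∃ (π : Equiv.Perm (Fin m)) (ε : Fin m → ℤˣ), ∏ i, ε i = 1 ∧
      StrictMono (fun i => |(ε i : ℤ) * X (π i)|) ∧
      ∀ i : Fin m, 0 < (i : ℕ) → 0 ≤ (ε i : ℤ) * X (π i) := by
  set π := Tuple.sort fun i => |X i|
  set σ : Fin m → ℤˣ := fun i => if 0 ≤ X (π i) then 1 else -1
  set z : Fin m := ⟨0, hm⟩
  refine ⟨π, Function.update σ z (∏ i ∈ Finset.univ.erase z, σ i), ?_, ?_, ?_⟩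
  · rw [← Finset.mul_prod_erase _ _ (Finset.mem_univ z), Function.update_self,
      Finset.prod_congr rfl fun i hi =>
        Function.update_of_ne (Finset.mem_erase.mp hi).1 _ σ]
    exact Int.units_mul_self _
  · have : StrictMono ((fun i => |X i|) ∘ π) :=
      (Tuple.monotone_sort _).strictMono_of_injective (hX.comp π.injective)
    intro i j hij
    simpa [abs_mul, Int.isUnit_iff_abs_eq.mp (Units.isUnit _)] using this hij
  · intro i hi
    have hiz : i ≠ z := fun h => hi.ne' (congrArg Fin.val h)
    rw [Function.update_of_ne hiz]
    simp only [σ]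
    split_ifs with h
    · simpa using h
    · simp; omega

/-- The signed permutation moving a vector to the open dominant chamber of type `D` is unique. -/
theorem signed_perm_dominant_unique {m : ℕ} (hm : 0 < m) (X : Fin m → ℤ)
    (π π' : Equiv.Perm (Fin m)) (ε ε' : Fin m → ℤˣ) (hε : ∏ i, ε i = 1) (hε' : ∏ i, ε' i = 1)
    (h : StrictMono fun i => |(ε i : ℤ) * X (π i)|)
    (hp : ∀ i : Fin m, 0 < (i : ℕ) → 0 ≤ (ε i : ℤ) * X (π i))
    (h' : StrictMono fun i => |(ε' i : ℤ) * X (π' i)|)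
    (hp' : ∀ i : Fin m, 0 < (i : ℕ) → 0 ≤ (ε' i : ℤ) * X (π' i)) :
    π = π' ∧ ε = ε' := by
  simp only [abs_mul, Int.isUnit_iff_abs_eq.mp (Units.isUnit _), one_mul] at h h'
  have hpi : π = π' := by
    have hinj : Function.Injective fun i => |X i| := by
      have := h.injective.comp π.symm.injective
      simpa [Function.comp_def] using this
    have hr : Set.range (fun i => |X (π i)|) = Set.range fun i => |X (π' i)| := by
      rw [show (fun i => |X (π i)|) = (fun i => |X i|) ∘ π from rfl,
        show (fun i => |X (π' i)|) = (fun i => |X i|) ∘ π' from rfl,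
        π.surjective.range_comp, π'.surjective.range_comp]
    have he := (h.range_inj h').mp hr
    exact Equiv.ext fun i => hinj (congrFun he i)
  subst hpi
  refine ⟨rfl, ?_⟩
  have hne : ∀ i : Fin m, i ≠ ⟨0, hm⟩ → ε i = ε' i := by
    intro i hi
    have hi0 : 0 < (i : ℕ) := Nat.pos_of_ne_zero fun h => hi (Fin.ext h)
    have hX : 0 < |X (π i)| :=
      (abs_nonneg _).trans_lt (h (show (⟨0, hm⟩ : Fin m) < i from hi0))
    have h1 := hp i hi0
    have h2 := hp' i hi0
    have hX' := abs_pos.mp hX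
    rcases Int.units_eq_one_or (ε i) with e | e <;> rcases Int.units_eq_one_or (ε' i) with e' | e'
      <;> rw [e, e'] <;> simp [e, e'] at h1 h2 <;> omega
  funext i
  by_cases hi : i = ⟨0, hm⟩
  · subst hi
    rw [← Finset.mul_prod_erase _ _ (Finset.mem_univ (⟨0, hm⟩ : Fin m))] at hε hε'
    rw [Finset.prod_congr rfl fun i hi => hne i (Finset.mem_erase.mp hi).1] at hε
    exact mul_right_cancel (hε.trans hε'.symm)
  · exact hne i hi

theorem monotone_abs_of_steps {m : ℕ} (hm : 2 ≤ m) (Y : Fin m → ℤ)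
    (h0 : 0 ≤ Y ⟨0, by omega⟩ + Y ⟨1, by omega⟩)
    (hs : ∀ j : Fin m, 1 ≤ (j : ℕ) → Y ⟨(j : ℕ) - 1, by omega⟩ ≤ Y j) :
    Monotone (fun i => |Y i|) ∧ ∀ i : Fin m, 0 < (i : ℕ) → 0 ≤ Y i := by
  have key : ∀ (k : ℕ) (hk : k + 1 < m), 0 ≤ Y ⟨k + 1, hk⟩ ∧
      ∀ i : Fin m, (i : ℕ) < k + 1 → |Y i| ≤ Y ⟨k + 1, hk⟩ := by
    intro k
    induction k with
    | zero =>
      intro hk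
      have h1 := hs ⟨1, by omega⟩ le_rfl
      simp only [Nat.sub_self] at h1
      refine ⟨by simp only [zero_add]; omega, fun i hi => ?_⟩
      obtain rfl : i = ⟨0, Nat.lt_of_succ_lt hk⟩ := Fin.ext (by simpa using hi)
      exact abs_le.mpr ⟨by simp only [zero_add]; omega, h1⟩
    | succ k ih =>
      intro hk
      obtain ⟨ih1, ih2⟩ := ih (by omega)
      have h1 := hs ⟨k + 1 + 1, hk⟩ (by simp)
      simp only [Nat.add_sub_cancel] at h1
      refine ⟨by omega, fun i hi => ?_⟩
      rcases Nat.lt_succ_iff_lt_or_eq.mp hi with hi | hi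
      · exact (ih2 i hi).trans h1
      · obtain rfl : i = ⟨k + 1, Nat.lt_of_succ_lt hk⟩ := Fin.ext hi
        rwa [abs_of_nonneg ih1]
  refine ⟨fun i j hij => ?_, fun i hi => ?_⟩
  · rcases hij.lt_or_eq with hij | rfl
    · obtain ⟨j, hj⟩ := j
      obtain _ | j := j
      · exact absurd hij (Nat.not_lt_zero _)
      · exact ((key j hj).2 i hij).trans (le_abs_self _)
    · exact le_rfl
  · obtain ⟨j, hj⟩ := i
    obtain _ | j := j
    · exact absurd hi (lt_irrefl _)
    · exact (key j hj).1

theorem strictMono_abs_iff_steps {m : ℕ} (hm : 2 ≤ m) (Y : Fin m → ℤ) :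
    (StrictMono (fun i => |Y i|) ∧ ∀ i : Fin m, 0 < (i : ℕ) → 0 ≤ Y i) ↔
    (0 < Y ⟨0, by omega⟩ + Y ⟨1, by omega⟩ ∧
      ∀ j : Fin m, 1 ≤ (j : ℕ) → Y ⟨(j : ℕ) - 1, by omega⟩ < Y j) := by
  constructor
  · rintro ⟨h, hp⟩
    have hlt : ∀ i j : Fin m, i < j → |Y i| < Y j := fun i j hij => by
      have h1 := h hij
      have h2 := hp j (by have : (i : ℕ) < j := hij; omega)
      simp only at h1
      rwa [abs_of_nonneg h2] at h1
    refine ⟨?_, fun j hj => ?_⟩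
    · have := (abs_lt.mp (hlt ⟨0, by omega⟩ ⟨1, by omega⟩ (Nat.zero_lt_one))).1
      omega
    · exact (abs_lt.mp (hlt ⟨(j : ℕ) - 1, by omega⟩ j
        (show (j : ℕ) - 1 < j by omega))).2
  · rintro ⟨h0, hs⟩
    obtain ⟨hm1, hp⟩ := monotone_abs_of_steps hm Y h0.le fun j hj => (hs j hj).le
    refine ⟨hm1.strictMono_of_injective ?_, hp⟩
    have hlt : ∀ i j : Fin m, i < j → |Y i| ≠ |Y j| := by
      intro i j hij he
      have hij' : (i : ℕ) < j := hij
      have h1 := hs j (by omega)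
      have h2 : |Y i| ≤ |Y ⟨(j : ℕ) - 1, by omega⟩| :=
        hm1 (show (i : ℕ) ≤ (j : ℕ) - 1 by omega)
      rw [he, abs_of_nonneg (hp j (by omega))] at h2
      rcases Nat.lt_or_ge 1 (j : ℕ) with hj | hj
      · rw [abs_of_nonneg (hp ⟨(j : ℕ) - 1, by omega⟩ (by simp only; omega))] at h2
        omega
      · obtain rfl : j = ⟨1, hm⟩ := Fin.ext (by simp only; omega)
        simp only [Nat.sub_self] at h1 h2
        rcases le_abs.mp h2 with h2 | h2 <;> omega
    intro i j he
    rcases lt_trichotomy i j with h | h | h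
    · exact absurd he (hlt i j h)
    · exact h
    · exact absurd he.symm (hlt j i h)

/-- Comparing the descent indicator with half the gap is the same as comparing the perturbed
coordinates. -/
theorem descent_le_iff {m : ℕ} {u v c : ℤ} (hu : |u| ≤ m) (hv : |v| ≤ m) (huv : v ≠ u) :
    (if v < u then (1 : ℤ) else 0) ≤ c ↔ 0 < (2 * m + 1) * (2 * c) + (v - u) := by
  rw [abs_le] at hu hv
  split_ifs with h
  · constructor
    · intro hc; nlinarith
    · intro hc; by_contra hn; have : c ≤ 0 := by omega
      nlinarith
  · constructor
    · intro hc; have : u < v := by omega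
      nlinarith
    · intro hc; by_contra hn; have : c ≤ -1 := by omega
      nlinarith

theorem injective_abs_perturb {m : ℕ} (x : Fin m → ℤ) :
    Function.Injective fun k : Fin m => |(2 * m + 1) * x k + ((k : ℕ) + 1)| := by
  intro i j h
  have hi : (i : ℕ) < m := i.2
  have hj : (j : ℕ) < m := j.2
  have small : ∀ t r : ℤ, (2 * (m : ℤ) + 1) * t = r → |r| < 2 * m + 1 → r = 0 := by
    intro t r h1 h2
    exact Int.eq_zero_of_abs_lt_dvd ⟨t, h1.symm⟩ h2
  rcases abs_eq_abs.mp h with h | h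
  · have := small (x i - x j) ((j : ℕ) - (i : ℕ)) (by linarith) (by rw [abs_lt]; omega)
    exact Fin.ext (by omega)
  · have h3 : ((i : ℕ) : ℤ) = j ∨ ((i : ℕ) : ℤ) ≠ j := em _
    rcases h3 with h3 | h3
    · exact Fin.ext (by omega)
    · have := small (x i + x j) (-((j : ℕ) + (i : ℕ) + 2)) (by linarith) (by rw [abs_lt]; omega)
      omega

/-- The perturbed vector `(2m+1) y + v` is strictly dominant exactly when the half-gaps of `y`
dominate the descent indicators of `v`. -/
theorem descents_le_iff_dominant {m : ℕ} (hm : 2 ≤ m) (y v c : Fin m → ℤ)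
    (hv : ∀ i, |v i| ≤ m) (hvv : ∀ i j, i ≠ j → v i ≠ v j ∧ v i ≠ -v j)
    (hc0 : 2 * c ⟨0, by omega⟩ = y ⟨0, by omega⟩ + y ⟨1, by omega⟩)
    (hc : ∀ j : Fin m, 1 ≤ (j : ℕ) → 2 * c j = y j - y ⟨(j : ℕ) - 1, by omega⟩) :
    (StrictMono (fun i => |(2 * m + 1) * y i + v i|) ∧
      ∀ i : Fin m, 0 < (i : ℕ) → 0 ≤ (2 * m + 1) * y i + v i) ↔
    ((if v ⟨0, by omega⟩ < -v ⟨1, by omega⟩ then (1 : ℤ) else 0) ≤ c ⟨0, by omega⟩ ∧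
      ∀ j : Fin m, 1 ≤ (j : ℕ) →
        (if v j < v ⟨(j : ℕ) - 1, by omega⟩ then (1 : ℤ) else 0) ≤ c j) := by
  rw [strictMono_abs_iff_steps hm fun i => (2 * m + 1) * y i + v i]
  refine and_congr ?_ (forall₂_congr fun j hj => ?_)
  · rw [descent_le_iff (m := m) (by rw [abs_neg]; exact hv _) (hv _)
      (hvv _ _ (by simp)).2, hc0, iff_iff_eq]
    congr 1
    ring
  · rw [descent_le_iff (m := m) (hv _) (hv _)
      (hvv _ _ (fun h => by have := congrArg Fin.val h; simp only at this; omega)).1, hc j hj,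
      ← sub_pos, iff_iff_eq]
    congr 1
    ring

theorem eq_of_steps_eq {m : ℕ} (hm : 2 ≤ m) (f g : Fin m → ℤ)
    (h0 : f ⟨0, by omega⟩ + f ⟨1, by omega⟩ = g ⟨0, by omega⟩ + g ⟨1, by omega⟩)
    (hs : ∀ j : Fin m, 1 ≤ (j : ℕ) →
      f j - f ⟨(j : ℕ) - 1, by omega⟩ = g j - g ⟨(j : ℕ) - 1, by omega⟩) :
    f = g := by
  have key : ∀ (k : ℕ) (hk : k < m), f ⟨k, hk⟩ = g ⟨k, hk⟩ := by
    intro k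
    induction k with
    | zero =>
      intro hk
      have := hs ⟨1, hm⟩ le_rfl
      simp only [Nat.sub_self] at this
      omega
    | succ k ih =>
      intro hk
      have h1 := hs ⟨k + 1, hk⟩ (by simp)
      have h2 := ih (by omega)
      simp only [Nat.add_sub_cancel] at h1
      omega
  exact funext fun i => key i i.2

theorem emod_two_eq_of_steps {m : ℕ} (f c : Fin m → ℤ)
    (hs : ∀ j : Fin m, 1 ≤ (j : ℕ) → 2 * c j = f j - f ⟨(j : ℕ) - 1, by omega⟩)
    (i j : Fin m) : f i % 2 = f j % 2 := by
  have key : ∀ (k : ℕ) (hk : k < m), f ⟨k, hk⟩ % 2 = f ⟨0, by omega⟩ % 2 := by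
    intro k
    induction k with
    | zero => exact fun _ => rfl
    | succ k ih =>
      intro hk
      have h1 := hs ⟨k + 1, hk⟩ (by simp)
      have h2 := ih (by omega)
      simp only [Nat.add_sub_cancel] at h1
      omega
  exact (key i i.2).trans (key j j.2).symm

theorem units_mul_emod_two (u : ℤˣ) (z : ℤ) : ((u : ℤ) * z) % 2 = z % 2 := by
  rcases Int.units_eq_one_or u with h | h <;> simp [h]

theorem abs_signed_perm {m : ℕ} (π : Equiv.Perm (Fin m)) (ε : Fin m → ℤˣ) (i : Fin m) :
    |(ε i : ℤ) * ((π i : ℕ) + 1)| = (π i : ℕ) + 1 := by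
  rw [abs_mul, Int.isUnit_iff_abs_eq.mp (ε i).isUnit, one_mul, abs_of_nonneg (by positivity)]

section Generators

variable {n : ℕ} {a : Fin (n - 1) → ℤ} {S : ℕ → ℤ} {b : Fin n → Fin n → ℤ}

theorem generators_sum_step (hm : 2 ≤ n - 1)
    (hb : ∀ j i : Fin n, b j i =
      if (j : ℕ) = n - 1 then (if (i : ℕ) = n - 1 then 1 else 0)
      else if (i : ℕ) = n - 1 then
        (if (j : ℕ) = 0 then S 0
         else if (j : ℕ) = 1 then S 1 - a ⟨0, by omega⟩
         else 2 * S (j : ℕ))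
      else
        (if (j : ℕ) = 0 then 1
         else if (j : ℕ) = 1 then (if (i : ℕ) = 0 then -1 else 1)
         else (if (j : ℕ) ≤ (i : ℕ) then 2 else 0))) (c : Fin n → ℤ) :
    2 * c ⟨0, by omega⟩ = ∑ j, c j * b j ⟨0, by omega⟩ + ∑ j, c j * b j ⟨1, by omega⟩ ∧
    ∀ i : Fin n, 1 ≤ (i : ℕ) → (i : ℕ) < n - 1 →
      2 * c i = ∑ j, c j * b j i - ∑ j, c j * b j ⟨(i : ℕ) - 1, by omega⟩ := by
  constructor
  · rw [← Finset.sum_add_distrib, Finset.sum_congr rfl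
      (g := fun j : Fin n => if j = ⟨0, by omega⟩ then 2 * c j else 0), Finset.sum_ite_eq']
    · simp
    · intro j _
      simp only [hb, Fin.ext_iff]
      split_ifs <;> first | omega | (exfalso; omega)
  · intro i hi hi'
    rw [← Finset.sum_sub_distrib, Finset.sum_congr rfl
      (g := fun j : Fin n => if j = i then 2 * c j else 0), Finset.sum_ite_eq']
    · simp
    · intro j _
      simp only [hb, Fin.ext_iff]
      split_ifs <;> omega

theorem generators_sum_last (hm : 2 ≤ n - 1)
    (hS : ∀ j, S j = ∑ i ∈ Finset.univ.filter (fun i : Fin (n - 1) => j ≤ (i : ℕ)), a i)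
    (hb : ∀ j i : Fin n, b j i =
      if (j : ℕ) = n - 1 then (if (i : ℕ) = n - 1 then 1 else 0)
      else if (i : ℕ) = n - 1 then
        (if (j : ℕ) = 0 then S 0
         else if (j : ℕ) = 1 then S 1 - a ⟨0, by omega⟩
         else 2 * S (j : ℕ))
      else
        (if (j : ℕ) = 0 then 1
         else if (j : ℕ) = 1 then (if (i : ℕ) = 0 then -1 else 1)
         else (if (j : ℕ) ≤ (i : ℕ) then 2 else 0))) (c : Fin n → ℤ) :
    ∑ j, c j * b j ⟨n - 1, by omega⟩ = c ⟨n - 1, by omega⟩ +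
      ∑ i : Fin (n - 1), a i * ∑ j, c j * b j (Fin.castLE (Nat.sub_le n 1) i) := by
  have hlast : ∀ j : Fin n, b j ⟨n - 1, by omega⟩ = (if j = ⟨n - 1, by omega⟩ then 1 else 0) +
      ∑ i : Fin (n - 1), a i * b j (Fin.castLE (Nat.sub_le n 1) i) := by
    intro j
    have hi : ∀ i : Fin (n - 1), (i : ℕ) ≠ n - 1 := fun i => by omega
    simp only [hb, Fin.ext_iff, Fin.val_castLE, if_neg (hi _), if_true]
    by_cases h1 : (j : ℕ) = n - 1
    · simp [h1]
    by_cases h2 : (j : ℕ) = 0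
    · simp [h2, hS, show ¬ 0 = n - 1 by omega]
    by_cases h3 : (j : ℕ) = 1
    · simp only [h3, if_neg (show ¬ 1 = n - 1 by omega), hS, one_ne_zero, if_false, if_true,
        zero_add, Finset.sum_filter]
      rw [sub_eq_iff_eq_add, ← Finset.sum_ite_eq' Finset.univ (⟨0, by omega⟩ : Fin (n - 1)) a
        |>.trans (if_pos (Finset.mem_univ _)), ← Finset.sum_add_distrib]
      refine Finset.sum_congr rfl fun i _ => ?_
      simp only [Fin.ext_iff]
      split_ifs <;> omega
    · simp only [if_neg h1, if_neg h2, if_neg h3, hS, zero_add, Finset.sum_filter, Finset.mul_sum]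
      refine Finset.sum_congr rfl fun i _ => ?_
      split_ifs <;> ring
  simp only [hlast, mul_add, Finset.sum_add_distrib, Finset.mul_sum, mul_ite, mul_one, mul_zero,
    Finset.sum_ite_eq', Finset.mem_univ, if_true]
  rw [Finset.sum_comm]
  congr 1
  refine Finset.sum_congr rfl fun i _ => Finset.sum_congr rfl fun j _ => ?_
  ring

end Generators

/-- type D bijective parameterization of the `Γ`-lattice
points. Indices are 0-based: the 0-based index `j` corresponds to the
1-based index `j+1`, so `S j = a_{j+1} + ⋯ + a_{n-1}` and `b` is the matrix
of generators of the fundamental cone (columns `b_1, …, b_n` of the paper in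
0-based coordinates). `val π ε j = ε_{j+1}·π(j+1)` encodes the signed
one-line notation; with the type-D convention `ε_0 π(0) := -ε_2 π(2)`,
`d π ε j` is the indicator that the generator index `j` lies in the type-D
descent set `D(π,ε)`. `Φ ((π,ε), lam)` is the point `x` with
`x_{π(i)} = ε_i y_i` for the first `n-1` coordinates and `x_{n-1} = y_{n-1}`,
where `y = ∑_j (lam_j + d_j) b_j`. The map `Φ`, restricted to the pairs with
`∏ ε = 1` (i.e. `(π,ε) ∈ S_{n-1} × E_{n-1}`), is a bijection onto `C ∩ Γ`. -/
theorem stmt_17 (n : ℕ) (hn : 3 ≤ n) (a : Fin (n - 1) → ℤ)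
    (ha1 : |a ⟨0, by omega⟩| ≤ a ⟨1, by omega⟩)
    (ha : ∀ j k : Fin (n - 1), 1 ≤ (j : ℕ) → j ≤ k → a j ≤ a k)
    (halast : 1 ≤ a ⟨n - 2, by omega⟩)
    (S : ℕ → ℤ)
    (hS : ∀ j, S j = ∑ i ∈ Finset.univ.filter (fun i : Fin (n - 1) => j ≤ (i : ℕ)), a i)
    (Γ : Set (Fin n → ℤ))
    (hΓ : Γ = {x | ∀ i j : Fin (n - 1),
      x (Fin.castLE (by omega) i) % 2 = x (Fin.castLE (by omega) j) % 2})
    (b : Fin n → Fin n → ℤ)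
    (hb : ∀ j i, b j i =
      if (j : ℕ) = n - 1 then (if (i : ℕ) = n - 1 then 1 else 0)
      else if (i : ℕ) = n - 1 then
        (if (j : ℕ) = 0 then S 0
         else if (j : ℕ) = 1 then S 1 - a ⟨0, by omega⟩
         else 2 * S (j : ℕ))
      else
        (if (j : ℕ) = 0 then 1
         else if (j : ℕ) = 1 then (if (i : ℕ) = 0 then -1 else 1)
         else (if (j : ℕ) ≤ (i : ℕ) then 2 else 0)))
    (val : Equiv.Perm (Fin (n - 1)) → (Fin (n - 1) → ℤˣ) → Fin (n - 1) → ℤ)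
    (hval : ∀ π ε j, val π ε j = (ε j : ℤ) * ((π j : ℕ) + 1))
    (d : Equiv.Perm (Fin (n - 1)) → (Fin (n - 1) → ℤˣ) → Fin n → ℤ)
    (hd : ∀ π ε j, d π ε j =
      if h : (j : ℕ) < n - 1 then
        (if (j : ℕ) = 0 then
          (if val π ε ⟨0, by omega⟩ < -val π ε ⟨1, by omega⟩ then 1 else 0)
         else (if val π ε ⟨(j : ℕ), h⟩ < val π ε ⟨(j : ℕ) - 1, by omega⟩ then 1 else 0))
      else 0)
    (Φ : (Equiv.Perm (Fin (n - 1)) × (Fin (n - 1) → ℤˣ)) × (Fin n → ℕ) → Fin n → ℤ)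
    (hΦ : ∀ π ε lam k, Φ ((π, ε), lam) k =
      if h : (k : ℕ) < n - 1 then
        (ε (π.symm ⟨(k : ℕ), h⟩) : ℤ) *
          ∑ j, ((lam j : ℤ) + d π ε j) * b j (Fin.castLE (by omega) (π.symm ⟨(k : ℕ), h⟩))
      else ∑ j, ((lam j : ℤ) + d π ε j) * b j ⟨n - 1, by omega⟩) :
    Set.BijOn Φ
      {p : (Equiv.Perm (Fin (n - 1)) × (Fin (n - 1) → ℤˣ)) × (Fin n → ℕ) | ∏ i, p.1.2 i = 1}
      ({x : Fin n → ℤ |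
          ∀ (π : Equiv.Perm (Fin (n - 1))) (ε : Fin (n - 1) → ℤˣ), (∏ i, ε i = 1) →
            ∑ i, (ε i : ℤ) * a i * x (Fin.castLE (by omega) (π i)) ≤ x ⟨n - 1, by omega⟩} ∩ Γ) := by
  have hm : 2 ≤ n - 1 := by omega
  have hlt : n - 1 ≤ n := Nat.sub_le n 1
  set T : (Fin n → ℤ) → Fin n → ℤ := fun c i => ∑ j, c j * b j i with hT
  have hT0 : ∀ c : Fin n → ℤ, 2 * c ⟨0, by omega⟩ = T c ⟨0, by omega⟩ + T c ⟨1, by omega⟩ :=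
    fun c => (generators_sum_step hm hb c).1
  have hTs : ∀ (c : Fin n → ℤ) (i : Fin (n - 1)), 1 ≤ (i : ℕ) → 2 * c (Fin.castLE hlt i) =
      T c (Fin.castLE hlt i) - T c (Fin.castLE hlt ⟨(i : ℕ) - 1, by omega⟩) :=
    fun c i hi => (generators_sum_step hm hb c).2 (Fin.castLE hlt i) hi i.2
  have hTl : ∀ c : Fin n → ℤ, T c ⟨n - 1, by omega⟩ = c ⟨n - 1, by omega⟩ +
      ∑ i : Fin (n - 1), a i * T c (Fin.castLE hlt i) := generators_sum_last hm hS hb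
  have hcases : ∀ j : Fin n, (∃ i : Fin (n - 1), j = Fin.castLE hlt i) ∨ j = ⟨n - 1, by omega⟩ := by
    intro j
    by_cases hj : (j : ℕ) < n - 1
    · exact Or.inl ⟨⟨j, hj⟩, rfl⟩
    · exact Or.inr (Fin.ext (by simp only; omega))
  have hΦ1 : ∀ π ε lam (i : Fin (n - 1)), Φ ((π, ε), lam) (Fin.castLE hlt (π i)) =
      (ε i : ℤ) * T (fun j => (lam j : ℤ) + d π ε j) (Fin.castLE hlt i) := by
    intro π ε lam i
    rw [hΦ, dif_pos (show ((Fin.castLE hlt (π i) : Fin n) : ℕ) < n - 1 from (π i).2)]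
    simp only [Fin.val_castLE, Fin.eta, Equiv.symm_apply_apply, hT]
  have hΦ2 : ∀ π ε lam, Φ ((π, ε), lam) ⟨n - 1, by omega⟩ =
      T (fun j => (lam j : ℤ) + d π ε j) ⟨n - 1, by omega⟩ := by
    intro π ε lam
    rw [hΦ, dif_neg (lt_irrefl _)]
  have hunit : ∀ (u : ℤˣ) (z : ℤ), (u : ℤ) * (u * z) = z := fun u z => by
    rw [← mul_assoc, Int.units_coe_mul_self, one_mul]
  have hdlast : ∀ π ε, d π ε ⟨n - 1, by omega⟩ = 0 := fun π ε => by
    rw [hd, dif_neg (lt_irrefl _)]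
  have hdom : ∀ (π : Equiv.Perm (Fin (n - 1))) (ε : Fin (n - 1) → ℤˣ)
      (x y c : Fin (n - 1) → ℤ), (∀ i, y i = ε i * x (π i)) →
      2 * c ⟨0, by omega⟩ = y ⟨0, by omega⟩ + y ⟨1, by omega⟩ →
      (∀ j : Fin (n - 1), 1 ≤ (j : ℕ) → 2 * c j = y j - y ⟨(j : ℕ) - 1, by omega⟩) →
      ((StrictMono (fun i => |(ε i : ℤ) *
          ((2 * ((n - 1 : ℕ) : ℤ) + 1) * x (π i) + ((π i : ℕ) + 1))|) ∧
        ∀ i : Fin (n - 1), 0 < (i : ℕ) → 0 ≤ (ε i : ℤ) *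
          ((2 * ((n - 1 : ℕ) : ℤ) + 1) * x (π i) + ((π i : ℕ) + 1))) ↔
        ∀ i, d π ε (Fin.castLE hlt i) ≤ c i) := by
    intro π ε x y c hy hc0 hc
    have hv : ∀ i, |val π ε i| = (π i : ℕ) + 1 := fun i => by rw [hval, abs_signed_perm]
    have hXY : ∀ i, (ε i : ℤ) * ((2 * ((n - 1 : ℕ) : ℤ) + 1) * x (π i) + ((π i : ℕ) + 1)) =
        (2 * ((n - 1 : ℕ) : ℤ) + 1) * y i + val π ε i := fun i => by
      rw [hval, hy]; ring
    simp only [hXY]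
    rw [descents_le_iff_dominant hm y (val π ε) c _ _ hc0 hc]
    · have hd' : ∀ i : Fin (n - 1), d π ε (Fin.castLE hlt i) =
          if (i : ℕ) = 0 then
            (if val π ε ⟨0, by omega⟩ < -val π ε ⟨1, by omega⟩ then 1 else 0)
          else (if val π ε i < val π ε ⟨(i : ℕ) - 1, by omega⟩ then 1 else 0) := fun i => by
        rw [hd, dif_pos (show ((Fin.castLE hlt i : Fin n) : ℕ) < n - 1 from i.2)]
        rfl
      constructor
      · rintro ⟨h0, h1⟩ i
        rw [hd']
        by_cases hi : (i : ℕ) = 0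
        · obtain rfl : i = ⟨0, Nat.lt_of_lt_of_le two_pos hm⟩ := Fin.ext hi
          rwa [if_pos rfl]
        · rw [if_neg hi]
          exact h1 i (by omega)
      · intro h
        refine ⟨?_, fun j hj => ?_⟩
        · have := h ⟨0, by omega⟩
          rwa [hd', if_pos rfl] at this
        · have := h j
          rwa [hd', if_neg (by omega)] at this
    · intro i
      rw [hv]
      have := (π i).2
      omega
    · intro i j hij
      have hne : ((π i : ℕ) : ℤ) ≠ (π j : ℕ) := fun h =>
        hij (π.injective (Fin.ext (by exact_mod_cast h)))
      rw [← not_or, ← abs_eq_abs, hv, hv]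
      omega
  have hd0 : ∀ π ε j, 0 ≤ d π ε j := fun π ε j => by
    rw [hd]
    split_ifs <;> simp
  have hdomΦ : ∀ π ε lam,
      (StrictMono (fun i => |(ε i : ℤ) * ((2 * ((n - 1 : ℕ) : ℤ) + 1) *
          Φ ((π, ε), lam) (Fin.castLE hlt (π i)) + ((π i : ℕ) + 1))|) ∧
        ∀ i : Fin (n - 1), 0 < (i : ℕ) → 0 ≤ (ε i : ℤ) * ((2 * ((n - 1 : ℕ) : ℤ) + 1) *
          Φ ((π, ε), lam) (Fin.castLE hlt (π i)) + ((π i : ℕ) + 1))) := fun π ε lam =>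
    (hdom π ε (fun k => Φ ((π, ε), lam) (Fin.castLE hlt k))
      (fun i => T (fun j => (lam j : ℤ) + d π ε j) (Fin.castLE hlt i))
      (fun i => (lam (Fin.castLE hlt i) : ℤ) + d π ε (Fin.castLE hlt i))
      (fun i => by simp only [hΦ1, hunit]) (hT0 fun j => (lam j : ℤ) + d π ε j)
      (hTs fun j => (lam j : ℤ) + d π ε j)).mpr fun i => by simp
  refine ⟨?_, ?_, ?_⟩
  · rintro ⟨⟨π, ε⟩, lam⟩ hε
    replace hε : ∏ i, ε i = 1 := hε
    have hx := hΦ1 π ε lam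
    have hxl := hΦ2 π ε lam
    set c : Fin n → ℤ := fun j => (lam j : ℤ) + d π ε j with hc
    have hc0 : ∀ j, 0 ≤ c j := fun j => add_nonneg (Int.natCast_nonneg _) (hd0 _ _ _)
    set y : Fin (n - 1) → ℤ := fun i => T c (Fin.castLE hlt i) with hy
    have hx' : ∀ k, Φ ((π, ε), lam) (Fin.castLE hlt k) = ε (π.symm k) * y (π.symm k) := fun k => by
      rw [← hx, Equiv.apply_symm_apply]
    constructor
    · intro π' ε' hε'
      obtain ⟨hy1, hy2⟩ := monotone_abs_of_steps hm y
        ((mul_nonneg zero_le_two (hc0 _)).trans_eq (hT0 c))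
        fun j hj => sub_nonneg.mp ((mul_nonneg zero_le_two (hc0 _)).trans_eq (hTs c j hj))
      obtain ⟨ha2, ha3⟩ := monotone_abs_of_steps hm a
        (by have := neg_abs_le (a ⟨0, by omega⟩); omega) fun j hj => by
          rcases Nat.lt_or_ge 1 (j : ℕ) with hj' | hj'
          · exact ha _ _ (by simp only; omega) (show (j : ℕ) - 1 ≤ j by omega)
          · obtain rfl : j = ⟨1, hm⟩ := Fin.ext (by simp only; omega)
            exact (le_abs_self _).trans ha1
      have hle := sum_signed_perm_le_s17 (by omega) a y ha2 ha3 hy1 hy2 (π'.trans π.symm)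
        (fun i => ε' i * ε (π.symm (π' i))) (by
          rw [Finset.prod_mul_distrib, hε', one_mul,
            Equiv.prod_comp π' fun k => ε (π.symm k), Equiv.prod_comp π.symm ε, hε])
      rw [hxl, hTl]
      refine le_trans (le_of_eq ?_) (hle.trans (le_add_of_nonneg_left (hc0 _)))
      refine Finset.sum_congr rfl fun i _ => ?_
      rw [hx', Units.val_mul, Equiv.trans_apply]
      ring
    · rw [hΓ]
      intro i j
      rw [hx', hx', units_mul_emod_two, units_mul_emod_two]
      exact emod_two_eq_of_steps y (fun i => c (Fin.castLE hlt i)) (hTs c) _ _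
  · rintro ⟨⟨π, ε⟩, lam⟩ hε ⟨⟨π', ε'⟩, lam'⟩ hε' h
    replace hε : ∏ i, ε i = 1 := hε
    replace hε' : ∏ i, ε' i = 1 := hε'
    have h1 := hdomΦ π ε lam
    have h2 := hdomΦ π' ε' lam'
    rw [← h] at h2
    obtain ⟨rfl, rfl⟩ := signed_perm_dominant_unique (by omega)
      (fun k => (2 * ((n - 1 : ℕ) : ℤ) + 1) * Φ ((π, ε), lam) (Fin.castLE hlt k) + ((k : ℕ) + 1))
      π π' ε ε' hε hε' h1.1 h1.2 h2.1 h2.2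
    have hTeq : T (fun j => (lam j : ℤ) + d π ε j) = T (fun j => (lam' j : ℤ) + d π ε j) := by
      funext j
      rcases hcases j with ⟨i, rfl⟩ | rfl
      · rw [← hunit (ε i) (T _ _), ← hΦ1, h, hΦ1, hunit]
      · rw [← hΦ2, h, hΦ2]
    have hlam : lam = lam' := by
      funext j
      rcases hcases j with ⟨i, rfl⟩ | rfl
      · rcases Nat.eq_zero_or_pos (i : ℕ) with hi | hi
        · obtain rfl : i = ⟨0, Nat.lt_of_lt_of_le two_pos hm⟩ := Fin.ext hi
          have e1 := hT0 fun j => (lam j : ℤ) + d π ε j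
          have e2 := hT0 fun j => (lam' j : ℤ) + d π ε j
          rw [hTeq, ← e2] at e1
          simp only [Fin.castLE_mk]
          omega
        · have e1 := hTs (fun j => (lam j : ℤ) + d π ε j) i hi
          have e2 := hTs (fun j => (lam' j : ℤ) + d π ε j) i hi
          rw [hTeq, ← e2] at e1
          omega
      · have e1 := hTl fun j => (lam j : ℤ) + d π ε j
        have e2 := hTl fun j => (lam' j : ℤ) + d π ε j
        rw [hTeq, e2] at e1
        omega
    rw [hlam]
  · rintro x ⟨hxC, hxΓ⟩
    rw [hΓ] at hxΓ
    obtain ⟨π, ε, hε, h1, h2⟩ := exists_signed_perm_dominant (by omega) _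
      (injective_abs_perturb fun k : Fin (n - 1) => x (Fin.castLE hlt k))
    set y : Fin (n - 1) → ℤ := fun i => ε i * x (Fin.castLE hlt (π i)) with hy
    have hpar : ∀ i j, y i % 2 = y j % 2 := fun i j => by
      simp only [hy, units_mul_emod_two]
      exact hxΓ _ _
    obtain ⟨c, hc0, hcs, hcl⟩ : ∃ c : Fin n → ℤ,
        2 * c ⟨0, by omega⟩ = y ⟨0, by omega⟩ + y ⟨1, by omega⟩ ∧
        (∀ j : Fin (n - 1), 1 ≤ (j : ℕ) →
          2 * c (Fin.castLE hlt j) = y j - y ⟨(j : ℕ) - 1, by omega⟩) ∧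
        c ⟨n - 1, by omega⟩ = x ⟨n - 1, by omega⟩ - ∑ i, a i * y i := by
      refine ⟨fun j => if h : (j : ℕ) < n - 1 then
        (if (j : ℕ) = 0 then (y ⟨0, by omega⟩ + y ⟨1, by omega⟩) / 2
          else (y ⟨j, h⟩ - y ⟨(j : ℕ) - 1, by omega⟩) / 2)
        else x ⟨n - 1, by omega⟩ - ∑ i, a i * y i, ?_, fun j hj => ?_, ?_⟩
      · beta_reduce
        rw [dif_pos (show 0 < n - 1 by omega), if_pos rfl]
        have := hpar ⟨0, by omega⟩ ⟨1, by omega⟩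
        omega
      · beta_reduce
        rw [dif_pos (show ((Fin.castLE hlt j : Fin n) : ℕ) < n - 1 from j.2),
          if_neg (show ¬ ((Fin.castLE hlt j : Fin n) : ℕ) = 0 from Nat.one_le_iff_ne_zero.mp hj)]
        simp only [Fin.val_castLE, Fin.eta]
        have := hpar j ⟨(j : ℕ) - 1, by omega⟩
        omega
      · exact dif_neg (lt_irrefl _)
    have hdc : ∀ j, d π ε j ≤ c j := by
      intro j
      rcases hcases j with ⟨i, rfl⟩ | rfl
      · exact (hdom π ε (fun k => x (Fin.castLE hlt k)) y (fun i => c (Fin.castLE hlt i))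
          (fun _ => rfl) hc0 hcs).mp ⟨h1, h2⟩ i
      · rw [hdlast, hcl]
        have := hxC π ε hε
        rw [sub_nonneg]
        refine le_trans (le_of_eq (Finset.sum_congr rfl fun i _ => ?_)) this
        simp only [hy]
        ring
    have hlam : (fun j => (((c j - d π ε j).toNat : ℕ) : ℤ) + d π ε j) = c := by
      funext j
      have := hdc j
      omega
    have hTy : (fun i => T c (Fin.castLE hlt i)) = y :=
      eq_of_steps_eq hm _ _ ((hT0 c).symm.trans hc0) fun j hj => (hTs c j hj).symm.trans (hcs j hj)
    refine ⟨((π, ε), fun j => (c j - d π ε j).toNat), hε, ?_⟩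
    funext k
    rcases hcases k with ⟨i, rfl⟩ | rfl
    · obtain ⟨i, rfl⟩ := π.surjective i
      rw [hΦ1, hlam, congrFun hTy i, hunit]
    · rw [hΦ2, hlam, hTl, hcl]
      simp only [fun i => congrFun hTy i]
      ring
end
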